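/- arXiv:math/0602010 — 3 statements merged into one kernel-verified Lean document; each statement's English description precedes it below -/
import Mathlib

section
/- Let H be a complex Hilbert space and A a densely defined self-adjoint unbounded operator on H with domain D(A). Let J : H → H be a map with J(D(A)) ⊆ D(A) and J(0) = 0, and suppose there exist functions C₀ : ℝ≥0 × ℝ≥0 → ℝ≥0 and C₁ : (ℝ≥0)⁴ → ℝ≥0, each finite everywhere and monotone increasing in each argument, such that for all φ, ψ ∈ D(A): ‖J(φ) − J(ψ)‖ ≤ C₀(‖φ‖, ‖ψ‖)·‖φ − ψ‖ and ‖A(J(φ)) − A(J(ψ))‖ ≤ C₁(‖φ‖, ‖Aφ‖, ‖ψ‖, ‖Aψ‖)·‖Aφ − Aψ‖. Then for every φ₀ ∈ D(A) there exists T > 0 and a continuously differentiable function φ : [0,T) → H with φ(t) ∈ D(A) for all t, φ(0) = φ₀ and φ′(t) = −i·A(φ(t)) + J(φ(t)) for all t ∈ [0,T); moreover this solution is unique: any two continuously differentiable D(A)-valued solutions of this initial value problem agree on the intersection of their intervals of existence. -/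
open Set Complex

variable {H : Type*} [NormedAddCommGroup H] [InnerProductSpace ℂ H] [CompleteSpace H]

/-- `φ` is a continuously differentiable `D(A)`-valued solution on the set `s`
(a time interval containing `0`) of the initial value problem
`φ′ = −i·A φ + J(φ)`, `φ(0) = φ₀`. -/
def IsSolOn (A : H →ₗ.[ℂ] H) (J : H → H) (φ₀ : H) (s : Set ℝ) (φ : ℝ → H) : Prop :=
  φ 0 = φ₀ ∧
  ∃ φ' : ℝ → H, ContinuousOn φ' s ∧
    ∀ t ∈ s, HasDerivWithinAt φ (φ' t) s t ∧
      ∃ h : φ t ∈ A.domain, φ' t = (-Complex.I) • A ⟨φ t, h⟩ + J (φ t)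

section ResolventOfSelfAdjoint

lemma isFormalAdjoint_self {A : H →ₗ.[ℂ] H} (hdense : Dense (A.domain : Set H))
    (hsa : A.adjoint = A) : A.IsFormalAdjoint A := by
  have h := LinearPMap.adjoint_isFormalAdjoint hdense
  rwa [hsa] at h

omit [CompleteSpace H] in
lemma inner_snd_fst_of_mem_graph {A : H →ₗ.[ℂ] H} (hA : A.IsFormalAdjoint A) {p q : H × H}
    (hp : p ∈ A.graph) (hq : q ∈ A.graph) : inner ℂ p.2 q.1 = inner ℂ p.1 q.2 := by
  obtain ⟨x, hx1, hx2⟩ := (LinearPMap.mem_graph_iff A).1 hp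
  obtain ⟨y, hy1, hy2⟩ := (LinearPMap.mem_graph_iff A).1 hq
  rw [← hx1, ← hx2, ← hy1, ← hy2]
  exact hA x y

/-- For a self-adjoint `A` and `c = ±i`, the operator `A + c` has an everywhere defined bounded
inverse. -/
lemma exists_resolvent {A : H →ₗ.[ℂ] H} (hdense : Dense (A.domain : Set H))
    (hsa : A.adjoint = A) {c : ℂ} (hre : c.re = 0) (hc : ‖c‖ = 1) :
    ∃ R : H →L[ℂ] H, (∀ x, (R x, x - c • R x) ∈ A.graph) ∧
      ∀ p ∈ A.graph, R (p.2 + c • p.1) = p.1 := by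
  have hconj : (starRingEnd ℂ) c = -c := by
    apply Complex.ext <;> simp [hre]
  have hsymm := isFormalAdjoint_self hdense hsa
  have hmax : ∀ y w : H, (∀ p ∈ A.graph, inner ℂ w p.1 = inner ℂ y p.2) →
      (y, w) ∈ A.graph := by
    intro y w h
    have h' : ∀ x : A.domain, inner ℂ w (x : H) = inner ℂ y (A x) :=
      fun x => h _ (A.mem_graph x)
    have hy : y ∈ A.adjoint.domain := LinearPMap.mem_adjoint_domain_of_exists y ⟨w, h'⟩
    have hg := A.adjoint.mem_graph ⟨y, hy⟩
    rw [LinearPMap.adjoint_apply_eq hdense ⟨y, hy⟩ h'] at hg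
    rwa [← congrArg LinearPMap.graph hsa]
  have hclosed : IsClosed (A.graph : Set (H × H)) :=
    IsSelfAdjoint.isClosed (LinearPMap.isSelfAdjoint_def.2 hsa)
  have hnorm : ∀ p ∈ A.graph, ‖p.2 + c • p.1‖ ^ 2 = ‖p.2‖ ^ 2 + ‖p.1‖ ^ 2 := by
    intro p hp
    have him : (inner ℂ p.2 p.1 : ℂ).im = 0 := by
      have h1 := inner_snd_fst_of_mem_graph hsymm hp hp
      have h2 := congrArg Complex.im (inner_conj_symm p.2 p.1)
      rw [← h1, Complex.conj_im] at h2
      linarith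
    rw [norm_add_sq (𝕜 := ℂ), inner_smul_right, norm_smul, hc]
    simp [hre, him]
  have : CompleteSpace A.graph := hclosed.completeSpace_coe
  let T : A.graph →L[ℂ] H :=
    (ContinuousLinearMap.snd ℂ H H + c • ContinuousLinearMap.fst ℂ H H).comp A.graph.subtypeL
  have hT : ∀ p : A.graph, T p = p.1.2 + c • p.1.1 := fun p => rfl
  have hbound : ∀ p : A.graph, ‖p‖ ≤ ((1 : NNReal) : ℝ) * ‖T p‖ := by
    intro p
    have h := hnorm p.1 p.2
    rw [← hT] at h
    rw [NNReal.coe_one, one_mul, Submodule.coe_norm, Prod.norm_def, max_le_iff]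
    constructor <;> refine (abs_le_of_sq_le_sq' ?_ (norm_nonneg _)).2 <;>
      nlinarith [sq_nonneg ‖p.1.1‖, sq_nonneg ‖p.1.2‖]
  have hanti := AddMonoidHomClass.antilipschitz_of_bound T hbound
  have hrc : IsClosed (LinearMap.range T.toLinearMap : Set H) := by
    simpa using! hanti.isClosed_range T.uniformContinuous
  have hker : LinearMap.ker T.toLinearMap = ⊥ := LinearMap.ker_eq_bot.2 hanti.injective
  have hrange : LinearMap.range T.toLinearMap = ⊤ := by
    rw [← hrc.submodule_topologicalClosure_eq, Submodule.topologicalClosure_eq_top_iff,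
      Submodule.eq_bot_iff]
    intro y hy
    have h0 : ∀ p ∈ A.graph, inner ℂ y (p.2 + c • p.1) = 0 := by
      intro p hp
      exact (Submodule.mem_orthogonal' _ _).1 hy _ ⟨⟨p, hp⟩, rfl⟩
    have hmem : (y, c • y) ∈ A.graph := by
      apply hmax
      intro p hp
      have := h0 p hp
      rw [inner_add_right, inner_smul_right] at this
      rw [inner_smul_left, hconj]
      linear_combination -this
    have h1 := h0 _ hmem
    have h2 : c * (2 * inner ℂ y y) = 0 := by
      rw [← h1]
      simp only [inner_add_right, inner_smul_right]
      ring
    have hc0 : c ≠ 0 := by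
      rintro rfl
      simp at hc
    simpa [hc0] using h2
  let e := ContinuousLinearEquiv.ofBijective T hker hrange
  refine ⟨(ContinuousLinearMap.fst ℂ H H).comp
    (A.graph.subtypeL.comp (e.symm : H →L[ℂ] A.graph)), fun x => ?_, fun p hp => ?_⟩
  · have h : T (e.symm x) = x := ContinuousLinearEquiv.ofBijective_apply_symm_apply T hker hrange x
    rw [hT] at h
    have : ((e.symm x).1.1, x - c • (e.symm x).1.1) = (e.symm x).1 :=
      Prod.ext rfl (by rw [sub_eq_iff_eq_add]; exact h.symm)
    change ((e.symm x).1.1, x - c • (e.symm x).1.1) ∈ A.graph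
    rw [this]
    exact (e.symm x).2
  · have h : e.symm (T ⟨p, hp⟩) = ⟨p, hp⟩ :=
      ContinuousLinearEquiv.ofBijective_symm_apply_apply T hker hrange _
    exact congrArg (fun q : A.graph => q.1.1) h

/-- The resolvent `(A + i)⁻¹` of a self-adjoint operator is a normal operator satisfying the
first resolvent identity, and it has dense range. -/
lemma exists_normal_resolvent {A : H →ₗ.[ℂ] H} (hdense : Dense (A.domain : Set H))
    (hsa : A.adjoint = A) :
    ∃ R : H →L[ℂ] H, (∀ x, (R x, x - I • R x) ∈ A.graph) ∧
      (∀ p ∈ A.graph, R (p.2 + I • p.1) = p.1) ∧ IsStarNormal R ∧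
      R - star R = (-2 * I) • (R * star R) ∧ DenseRange R := by
  obtain ⟨R, hR, hR'⟩ := exists_resolvent hdense hsa (c := I) (by simp) (by simp)
  obtain ⟨S, hS, hS'⟩ := exists_resolvent hdense hsa (c := -I) (by simp) (by simp)
  have hsymm := isFormalAdjoint_self hdense hsa
  have hstar : star R = S := by
    rw [ContinuousLinearMap.star_eq_adjoint, eq_comm, ContinuousLinearMap.eq_adjoint_iff]
    intro x y
    have h := inner_snd_fst_of_mem_graph hsymm (hS x) (hR y)
    simp only [inner_sub_left, inner_sub_right, inner_smul_left, inner_smul_right, map_neg,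
      conj_I] at h
    linear_combination -h
  have h1 : R - S = (-2 * I) • (R * S) := by
    ext x
    have h := hR' _ (hS x)
    simp only [map_add, map_sub, map_smul] at h
    change R x - S x = (-2 * I) • R (S x)
    linear_combination (norm := module) h
  have h2 : R - S = (-2 * I) • (S * R) := by
    ext x
    have h := hS' _ (hR x)
    simp only [map_add, map_sub, map_smul] at h
    change R x - S x = (-2 * I) • S (R x)
    linear_combination (norm := module) -h
  refine ⟨R, hR, hR', ⟨?_⟩, hstar ▸ h1, hdense.mono ?_⟩
  · rw [hstar]
    exact smul_right_injective _ (by simp : (-2 * I : ℂ) ≠ 0) (h2.symm.trans h1)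
  · intro x hx
    exact ⟨_, hR' _ (A.mem_graph ⟨x, hx⟩)⟩

end ResolventOfSelfAdjoint

section UnitaryGroup

/-- In terms of the resolvent variable `z = (x + i)⁻¹`, this is the function
`x ↦ (x + i)⁻¹ exp (-itx)`. -/
noncomputable def resolventPhase (t : ℝ) (z : ℂ) : ℂ :=
  z * Complex.exp (I * ((-(t * z⁻¹.re) : ℝ) : ℂ))

lemma norm_resolventPhase (t : ℝ) (z : ℂ) : ‖resolventPhase t z‖ = ‖z‖ := by
  rw [resolventPhase, norm_mul, Complex.norm_exp_I_mul_ofReal, mul_one]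

lemma continuous_resolventPhase (t : ℝ) : Continuous (resolventPhase t) := by
  rw [continuous_iff_continuousAt]
  intro z
  rcases eq_or_ne z 0 with rfl | hz
  · have h0 : resolventPhase t 0 = 0 := by simp [resolventPhase]
    rw [ContinuousAt, h0, tendsto_zero_iff_norm_tendsto_zero]
    simp only [norm_resolventPhase]
    exact tendsto_norm_zero
  · have h : ContinuousAt (fun z : ℂ => z⁻¹.re) z :=
      Complex.continuous_re.continuousAt.comp (continuousAt_inv₀ hz)
    unfold resolventPhase
    fun_prop

lemma resolventPhase_zero (z : ℂ) : resolventPhase 0 z = z := by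
  simp [resolventPhase]

lemma resolventPhase_mul_neg (t : ℝ) (z : ℂ) :
    resolventPhase t z * resolventPhase (-t) z = z * z := by
  rw [resolventPhase, resolventPhase, mul_mul_mul_comm, ← Complex.exp_add]
  simp

lemma norm_re_inv_mul_le (z : ℂ) : |z⁻¹.re| * ‖z‖ ≤ 1 := by
  rcases eq_or_ne z 0 with rfl | hz
  · simp
  · calc |z⁻¹.re| * ‖z‖ ≤ ‖z⁻¹‖ * ‖z‖ := by gcongr; exact Complex.abs_re_le_norm _
      _ = 1 := by rw [norm_inv, inv_mul_cancel₀ (norm_ne_zero_iff.2 hz)]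

lemma norm_resolventPhase_sub_le (s t : ℝ) (z : ℂ) :
    ‖resolventPhase s z - resolventPhase t z‖ ≤ |s - t| := by
  have h : resolventPhase s z - resolventPhase t z = resolventPhase t z *
      (Complex.exp (I * ((-((s - t) * z⁻¹.re) : ℝ) : ℂ)) - 1) := by
    rw [resolventPhase, resolventPhase, mul_sub, mul_assoc z, ← Complex.exp_add]
    push_cast
    ring_nf
  rw [h, norm_mul, norm_resolventPhase]
  calc _ ≤ ‖z‖ * ‖-((s - t) * z⁻¹.re)‖ := by
        gcongr; exact Real.norm_exp_I_mul_ofReal_sub_one_le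
    _ = |s - t| * (|z⁻¹.re| * ‖z‖) := by
        rw [norm_neg, norm_mul, Real.norm_eq_abs, Real.norm_eq_abs]
        ring
    _ ≤ |s - t| := mul_le_of_le_one_right (abs_nonneg _) (norm_re_inv_mul_le z)

lemma norm_exp_I_mul_sub_one_sub_le (x : ℝ) :
    ‖Complex.exp (I * x) - 1 - I * x‖ ≤ 2 * x ^ 2 := by
  have hn : ‖I * (x : ℂ)‖ = |x| := by simp
  rcases le_total |x| 1 with hx | hx
  · have h := Complex.norm_exp_sub_one_sub_id_le (hn.trans_le hx)
    rw [hn, sq_abs] at h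
    nlinarith [sq_nonneg x]
  · have h1 : ‖Complex.exp (I * x) - 1‖ ≤ |x| := Real.norm_exp_I_mul_ofReal_sub_one_le
    have h2 := norm_sub_le (Complex.exp (I * x) - 1) (I * x)
    rw [hn] at h2
    nlinarith [sq_abs x]

lemma norm_mul_resolventPhase_sub_le (s t : ℝ) {z : ℂ}
    (hz : z - star z = (-2 * I) * (z * star z)) :
    ‖z * resolventPhase s z - z * resolventPhase t z
      - ((s - t : ℝ) : ℂ) * (-I * (1 - I * z) * resolventPhase t z)‖ ≤ 2 * (s - t) ^ 2 := by
  rcases eq_or_ne z 0 with rfl | h0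
  · simp [resolventPhase]
    positivity
  have hx : (z⁻¹.re : ℂ) * z = 1 - I * z := by
    have hs : star z ≠ 0 := star_ne_zero.2 h0
    have hre : (z⁻¹.re : ℂ) = (z⁻¹ + (star z)⁻¹) / 2 := by
      rw [← star_inv₀, Complex.re_eq_add_conj]
      rfl
    rw [hre]
    field_simp
    linear_combination hz
  have h : z * resolventPhase s z - z * resolventPhase t z
      - ((s - t : ℝ) : ℂ) * (-I * (1 - I * z) * resolventPhase t z) =
      z * resolventPhase t z * (Complex.exp (I * ((-((s - t) * z⁻¹.re) : ℝ) : ℂ)) - 1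
        - I * ((-((s - t) * z⁻¹.re) : ℝ) : ℂ)) := by
    have he : resolventPhase s z = resolventPhase t z *
        Complex.exp (I * ((-((s - t) * z⁻¹.re) : ℝ) : ℂ)) := by
      rw [resolventPhase, resolventPhase, mul_assoc z, ← Complex.exp_add]
      push_cast
      ring_nf
    rw [← hx, he]
    push_cast
    ring
  rw [h, norm_mul, norm_mul, norm_resolventPhase]
  calc _ ≤ ‖z‖ * ‖z‖ * (2 * (-((s - t) * z⁻¹.re)) ^ 2) := by
        gcongr; exact norm_exp_I_mul_sub_one_sub_le _
    _ = 2 * (s - t) ^ 2 * (|z⁻¹.re| * ‖z‖) ^ 2 := by rw [mul_pow |_|, sq_abs]; ring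
    _ ≤ 2 * (s - t) ^ 2 := mul_le_of_le_one_right (by positivity)
        (pow_le_one₀ (by positivity) (norm_re_inv_mul_le z))

/-- The unitary group `exp (-itA)`, expressed through `R = (A + i)⁻¹`: along `R ∘ U` the
generator is the bounded operator `-i A R = -i (1 - i R)`. -/
lemma exists_unitary_group {R : H →L[ℂ] H} (hn : IsStarNormal R)
    (hR : R - star R = (-2 * I) • (R * star R)) (hd : DenseRange R) :
    ∃ U : ℝ → H →L[ℂ] H, U 0 = 1 ∧ (∀ t x, ‖U t x‖ ≤ ‖x‖) ∧ (∀ t x, U t (U (-t) x) = x) ∧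
      (∀ x, Continuous fun t => U t x) ∧
      ∀ x t, HasDerivAt (fun s => R (U s x)) (-I • (U t x - I • R (U t x))) t := by
  have hcont := continuous_resolventPhase
  let V : ℝ → H →L[ℂ] H := fun t => cfc (resolventPhase t) R
  have hspec : ∀ z ∈ spectrum ℂ R, z - star z = (-2 * I) * (z * star z) := by
    have h : cfc (fun z : ℂ => z - star z) R = cfc (fun z : ℂ => (-2 * I) * (z * star z)) R := by
      rw [cfc_sub (fun z : ℂ => z) (fun z => star z) R, cfc_const_mul (-2 * I) _ R,
        cfc_mul (fun z : ℂ => z) (fun z => star z) R, cfc_star (fun z : ℂ => z) R, cfc_id' ℂ R, hR]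
    exact (cfc_eq_cfc_iff_eqOn (R := ℂ)).1 h
  have hcommRV : ∀ t, R * V t = V t * R := fun t => by
    have h := cfc_commute_cfc id (resolventPhase t) R
    rw [cfc_id ℂ R] at h
    exact h.eq
  have hV0 : V 0 = R := by
    simp only [V, funext resolventPhase_zero]
    exact cfc_id' ℂ R
  have hVV : ∀ t, V t * V (-t) = R * R := by
    intro t
    rw [← cfc_mul _ _ R (hcont t).continuousOn (hcont (-t)).continuousOn]
    simp only [resolventPhase_mul_neg]
    rw [cfc_mul (fun z : ℂ => z) (fun z => z) R, cfc_id' ℂ R]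
  have hVnorm : ∀ t x, ‖V t x‖ = ‖R x‖ := by
    intro t x
    have h : star (V t) * V t = star R * R := by
      have hp : (fun z : ℂ => star (resolventPhase t z) * resolventPhase t z) =
          fun z : ℂ => star z * z := by
        ext z
        have := norm_resolventPhase t z
        rw [mul_comm, mul_comm (star z)]
        simp only [RCLike.star_def, Complex.mul_conj', this]
      rw [← cfc_star (resolventPhase t) R,
        ← cfc_mul (fun z => star (resolventPhase t z)) (resolventPhase t) R
          (hcont t).star.continuousOn (hcont t).continuousOn, hp,
        cfc_mul (fun z : ℂ => star z) (fun z => z) R, cfc_star (fun z : ℂ => z) R, cfc_id' ℂ R]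
    have hsq : ∀ T : H →L[ℂ] H, ‖T x‖ ^ 2 = RCLike.re (inner ℂ ((star T * T) x) x) := fun T => by
      rw [← inner_self_eq_norm_sq (𝕜 := ℂ), ← ContinuousLinearMap.adjoint_inner_left]
      rfl
    exact (sq_eq_sq₀ (norm_nonneg _) (norm_nonneg _)).1 (by rw [hsq, hsq, h])
  have hVlip : ∀ s t, ‖V s - V t‖ ≤ |s - t| := by
    intro s t
    rw [← cfc_sub _ _ R (hcont s).continuousOn (hcont t).continuousOn]
    exact norm_cfc_le (abs_nonneg _) fun z _ => norm_resolventPhase_sub_le s t z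
  have hVderiv : ∀ t, HasDerivAt (fun s => R * V s) (-I • (V t - I • (R * V t))) t := by
    intro t
    have hbound : ∀ s, ‖R * V s - R * V t - (s - t) • (-I • (V t - I • (R * V t)))‖
        ≤ 2 * ‖s - t‖ ^ 2 := by
      intro s
      have hm : ∀ r, R * V r = cfc (fun z => z * resolventPhase r z) R := fun r => by
        rw [cfc_mul (fun z : ℂ => z) _ R continuousOn_id (hcont r).continuousOn, cfc_id' ℂ R]
      have hcs := hcont s
      have hct := hcont t
      have hD : (s - t) • (-I • (V t - I • (R * V t))) =
          cfc (fun z => ((s - t : ℝ) : ℂ) * (-I * (1 - I * z) * resolventPhase t z)) R := by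
        have : (fun z => ((s - t : ℝ) : ℂ) * (-I * (1 - I * z) * resolventPhase t z)) =
            fun z => (((s - t : ℝ) : ℂ) * -I) * (resolventPhase t z -
              I * (z * resolventPhase t z)) := by ext z; ring
        rw [this, cfc_const_mul _ _ R (by fun_prop), cfc_sub _ _ R (by fun_prop) (by fun_prop),
          cfc_const_mul _ _ R (by fun_prop), ← hm, mul_smul, Complex.coe_smul]
      rw [hD, hm, hm, ← cfc_sub _ _ R (by fun_prop) (by fun_prop),
        ← cfc_sub _ _ R (by fun_prop) (by fun_prop), Real.norm_eq_abs, sq_abs]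
      exact norm_cfc_le (by positivity) fun z hz =>
        norm_mul_resolventPhase_sub_le s t (hspec z hz)
    rw [hasDerivAt_iff_isLittleO]
    refine (Asymptotics.IsBigO.of_bound 2 (Filter.Eventually.of_forall fun s => ?_)).trans_isLittleO
      (Asymptotics.isLittleO_pow_sub_sub t one_lt_two)
    simpa using! hbound s
  have hnormV : ∀ t x, ‖(V t).toLinearMap x‖ ≤ 1 * ‖R.toLinearMap x‖ := fun t x => by
    rw [one_mul]; exact (hVnorm t x).le
  let U : ℝ → H →L[ℂ] H := fun t => (V t).toLinearMap.extendOfNorm R.toLinearMap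
  have hUR : ∀ t x, U t (R x) = V t x := fun t x =>
    LinearMap.extendOfNorm_eq hd ⟨1, hnormV t⟩ x
  have hUnorm : ∀ t x, ‖U t x‖ ≤ ‖x‖ := fun t x => by
    have := LinearMap.norm_extendOfNorm_apply_le hd 1 (hnormV t) x
    rwa [one_mul] at this
  have hVR : ∀ t x, V t (R x) = R (V t x) := fun t x => (DFunLike.congr_fun (hcommRV t) x).symm
  have hext : ∀ S T : H →L[ℂ] H, (∀ x, S (R x) = T (R x)) → S = T := fun S T h =>
    DFunLike.coe_injective (hd.equalizer S.continuous T.continuous (funext h))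
  have hRU : ∀ t x, R (U t x) = V t x := fun t => DFunLike.congr_fun
    (hext (R * U t) (V t) fun x => by simp [hUR, hVR])
  have hconv : ∀ x, ∃ y : ℕ → H, Filter.Tendsto (fun n => R (y n)) Filter.atTop (nhds x) := by
    intro x
    obtain ⟨u, hu, hux⟩ := mem_closure_iff_seq_limit.1 (hd x)
    choose y hy using hu
    exact ⟨y, by simpa only [hy] using hux⟩
  have hunif : ∀ (x : H) (y : ℕ → H), Filter.Tendsto (fun n => R (y n)) Filter.atTop (nhds x) →
      TendstoUniformly (fun n t => U t (R (y n))) (fun t => U t x) Filter.atTop := by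
    intro x y hy
    rw [Metric.tendstoUniformly_iff]
    intro ε hε
    filter_upwards [Metric.tendsto_nhds.1 hy ε hε] with n hn t
    rw [dist_eq_norm, ← map_sub]
    refine (hUnorm _ _).trans_lt ?_
    rwa [← dist_eq_norm, dist_comm]
  refine ⟨U, ?_, hUnorm, ?_, ?_, ?_⟩
  · exact hext _ _ fun x => by rw [hUR, hV0]; rfl
  · intro t
    refine DFunLike.congr_fun (f := U t * U (-t)) (g := 1) (hext _ _ ?_)
    refine DFunLike.congr_fun (f := U t * U (-t) * R) (g := R) (hext _ _ fun x => ?_)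
    simpa [hUR, hVR] using DFunLike.congr_fun (hVV t) x
  · intro x
    obtain ⟨y, hy⟩ := hconv x
    refine (hunif x y hy).continuous (Filter.Frequently.of_forall fun n => ?_)
    simp only [hUR]
    refine (LipschitzWith.of_dist_le_mul (K := ‖y n‖₊) fun s t => ?_).continuous
    rw [dist_eq_norm, ← sub_apply, Real.dist_eq, mul_comm]
    exact ((V s - V t).le_opNorm _).trans (by gcongr; exacts [hVlip s t, le_rfl])
  · intro x
    obtain ⟨y, hy⟩ := hconv x
    let D : H →L[ℂ] H := -I • (1 - I • R)
    have hD : UniformContinuous D := D.uniformContinuous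
    refine hasDerivAt_of_tendstoUniformly (hD.comp_tendstoUniformly (hunif x y hy))
      (f := fun n s => R (U s (R (y n)))) (Filter.Eventually.of_forall fun n t => ?_)
      fun t => ((R.continuous.comp (U t).continuous).tendsto x).comp hy
    have h := ((ContinuousLinearMap.apply ℂ H (y n)).restrictScalars ℝ).hasFDerivAt.comp_hasDerivAt t
      (hVderiv t)
    simp only [hUR]
    exact h

end UnitaryGroup

section MildSolution

omit [CompleteSpace H] in
lemma tendsto_apply_of_contraction {ι : Type*} {l : Filter ι} {U : ι → H →L[ℂ] H}
    (hU : ∀ i x, ‖U i x‖ ≤ ‖x‖) {v : ι → H} {a b : H} (hv : Filter.Tendsto v l (nhds a))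
    (ha : Filter.Tendsto (fun i => U i a) l (nhds b)) :
    Filter.Tendsto (fun i => U i (v i)) l (nhds b) := by
  have h : Filter.Tendsto (fun i => U i (v i - a)) l (nhds 0) :=
    squeeze_zero_norm (fun i => hU i _) (by simpa using (hv.sub_const a).norm)
  simpa using h.add ha

omit [CompleteSpace H] in
lemma hasDerivWithinAt_apply_of_contraction {R : H →L[ℂ] H} {U : ℝ → H →L[ℂ] H}
    (hU : ∀ t x, ‖U t x‖ ≤ ‖x‖) (hUc : ∀ x, Continuous fun t => U t x) {η : ℝ → H} {η' d : H}
    {s : Set ℝ} {t : ℝ} (hη : HasDerivWithinAt η η' s t)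
    (hd : HasDerivAt (fun r => R (U r (η t))) d t) :
    HasDerivWithinAt (fun r => R (U r (η r))) (d + R (U t η')) s t := by
  rw [hasDerivWithinAt_iff_tendsto_slope] at hη ⊢
  have h1 := hasDerivWithinAt_iff_tendsto_slope.1 (hd.hasDerivWithinAt (s := s))
  have h2 := tendsto_apply_of_contraction hU hη (((hUc η').tendsto t).mono_left nhdsWithin_le_nhds)
  refine (h1.add ((R.continuous.tendsto _).comp h2)).congr fun r => ?_
  simp only [slope, vsub_eq_sub, Function.comp_apply, ← Complex.coe_smul, map_smul, map_sub]
  module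

omit [InnerProductSpace ℂ H] [CompleteSpace H] in
lemma continuous_of_lipschitzOnWith_closedBall {K : H → H}
    (hK : ∀ r : NNReal, ∃ L, LipschitzOnWith L K (Metric.closedBall 0 r)) : Continuous K := by
  refine continuous_iff_continuousAt.2 fun x => ?_
  obtain ⟨L, hL⟩ := hK (‖x‖₊ + 1)
  exact hL.continuousOn.continuousAt (Metric.closedBall_mem_nhds_of_mem (by simp))

/-- Local existence for `χ' = -i A χ + K χ` with `K` locally Lipschitz, formulated after applying
the resolvent `R = (A + i)⁻¹`. -/
lemma exists_local_solution_of_unitary_group {R : H →L[ℂ] H} {U : ℝ → H →L[ℂ] H} (hU0 : U 0 = 1)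
    (hU : ∀ t x, ‖U t x‖ ≤ ‖x‖) (hinv : ∀ t x, U t (U (-t) x) = x)
    (hUc : ∀ x, Continuous fun t => U t x)
    (hd : ∀ x t, HasDerivAt (fun s => R (U s x)) (-I • (U t x - I • R (U t x))) t)
    {K : H → H} (hK : ∀ r : NNReal, ∃ L, LipschitzOnWith L K (Metric.closedBall 0 r)) (χ₀ : H) :
    ∃ T > (0 : ℝ), ∃ χ : ℝ → H, χ 0 = χ₀ ∧ ContinuousOn χ (Icc 0 T) ∧ ∀ t ∈ Icc 0 T,
      HasDerivWithinAt (fun s => R (χ s)) (-I • (χ t - I • R (χ t)) + R (K (χ t)))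
        (Icc 0 T) t := by
  obtain ⟨L, hL⟩ := hK (‖χ₀‖₊ + 1)
  set ρ : NNReal := ‖χ₀‖₊ + 1 with hρ
  have hball : ∀ t, ∀ x ∈ Metric.closedBall χ₀ (1 : NNReal),
      U t x ∈ Metric.closedBall (0 : H) ρ := by
    intro t x hx
    rw [mem_closedBall_zero_iff]
    rw [mem_closedBall_iff_norm] at hx
    calc ‖U t x‖ ≤ ‖χ₀ + (x - χ₀)‖ := by rw [add_sub_cancel]; exact hU t x
      _ ≤ ‖χ₀‖ + ‖x - χ₀‖ := norm_add_le _ _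
      _ ≤ ρ := by rw [hρ, NNReal.coe_add, coe_nnnorm]; gcongr
  have hKcont := continuous_of_lipschitzOnWith_closedBall hK
  let M : NNReal := ‖K 0‖₊ + L * ρ
  have hM : ∀ x ∈ Metric.closedBall (0 : H) ρ, ‖K x‖ ≤ M := by
    intro x hx
    have h := hL.norm_sub_le hx (Metric.mem_closedBall_self ρ.2)
    rw [sub_zero] at h
    rw [mem_closedBall_zero_iff] at hx
    calc ‖K x‖ = ‖K 0 + (K x - K 0)‖ := by rw [add_sub_cancel]
      _ ≤ ‖K 0‖ + ‖K x - K 0‖ := norm_add_le _ _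
      _ ≤ ‖K 0‖ + L * ρ := by gcongr; exact h.trans (by gcongr)
  let T : ℝ := 1 / (M + 1)
  have hT : 0 < T := by positivity
  have hPL : IsPicardLindelof (fun t x => U (-t) (K (U t x))) (tmin := 0) (tmax := T)
      ⟨0, left_mem_Icc.2 hT.le⟩ χ₀ 1 0 M L := by
    refine ⟨fun t _ => ?_, fun x _ => ?_, fun t _ x hx => ?_, ?_⟩
    · refine LipschitzOnWith.of_dist_le_mul fun x hx y hy => ?_
      rw [dist_eq_norm, dist_eq_norm, ← map_sub]
      refine (hU _ _).trans ((hL.norm_sub_le (hball t x hx) (hball t y hy)).trans ?_)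
      rw [← map_sub]
      gcongr
      exact hU _ _
    · refine (continuous_iff_continuousAt.2 fun t => ?_).continuousOn
      exact tendsto_apply_of_contraction (U := fun t => U (-t)) (fun t => hU (-t))
        ((hKcont.comp (hUc x)).tendsto t) (((hUc _).comp continuous_neg).tendsto t)
    · exact (hU _ _).trans (hM _ (hball t x hx))
    · simp only [sub_zero, sub_self, max_eq_left hT.le, NNReal.coe_one, NNReal.coe_zero, T]
      rw [mul_one_div, div_le_one (by positivity)]
      linarith
  obtain ⟨η, hη0, hη⟩ := hPL.exists_eq_forall_mem_Icc_hasDerivWithinAt₀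
  refine ⟨T, hT, fun t => U t (η t), ?_, fun t ht => ?_, fun t ht => ?_⟩
  · change U 0 (η 0) = χ₀
    rw [hU0]
    exact hη0
  · exact tendsto_apply_of_contraction hU (hη t ht).continuousWithinAt
      (((hUc _).tendsto t).mono_left nhdsWithin_le_nhds)
  · have h := hasDerivWithinAt_apply_of_contraction hU hUc (hη t ht) (hd (η t) t)
    rwa [hinv] at h

end MildSolution

section Uniqueness

omit [CompleteSpace H] in
/-- Two solutions of the initial value problem agree, since the difference `w` satisfies
`|d/dt ‖w‖²| ≤ 2 C₀ ‖w‖²`. -/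
lemma eqOn_of_isSolOn {A : H →ₗ.[ℂ] H} (hsymm : A.IsFormalAdjoint A) {J : H → H}
    {C₀ : NNReal → NNReal → NNReal} (hC₀mono : ∀ a b a' b', a ≤ a' → b ≤ b' → C₀ a b ≤ C₀ a' b')
    (hLip₀ : ∀ φ ψ : A.domain,
      ‖J ↑φ - J ↑ψ‖ ≤ (C₀ ‖(φ : H)‖₊ ‖(ψ : H)‖₊ : ℝ) * ‖(φ : H) - (ψ : H)‖)
    {φ₀ : H} {T₁ T₂ : ℝ} {φ ψ : ℝ → H} (hφ : IsSolOn A J φ₀ (Ico 0 T₁) φ)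
    (hψ : IsSolOn A J φ₀ (Ico 0 T₂) ψ) : EqOn φ ψ (Ico 0 (min T₁ T₂)) := by
  intro τ hτ
  obtain ⟨hφ0, φ', -, hφ⟩ := hφ
  obtain ⟨hψ0, ψ', -, hψ⟩ := hψ
  have hsub₁ : Icc 0 τ ⊆ Ico 0 T₁ := fun t ht =>
    ⟨ht.1, ht.2.trans_lt (hτ.2.trans_le (min_le_left _ _))⟩
  have hsub₂ : Icc 0 τ ⊆ Ico 0 T₂ := fun t ht =>
    ⟨ht.1, ht.2.trans_lt (hτ.2.trans_le (min_le_right _ _))⟩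
  have hφc : ContinuousOn φ (Icc 0 τ) := fun t ht =>
    ((hφ t (hsub₁ ht)).1.mono hsub₁).continuousWithinAt
  have hψc : ContinuousOn ψ (Icc 0 τ) := fun t ht =>
    ((hψ t (hsub₂ ht)).1.mono hsub₂).continuousWithinAt
  obtain ⟨a, ha⟩ := isCompact_Icc.exists_bound_of_continuousOn hφc
  obtain ⟨b, hb⟩ := isCompact_Icc.exists_bound_of_continuousOn hψc
  let w : ℝ → H := fun t => φ t - ψ t
  let w' : ℝ → H := fun t => φ' t - ψ' t
  have hw : ∀ t ∈ Ico 0 τ, HasDerivWithinAt w (w' t) (Ici t) t := by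
    intro t ht
    have ht' : t ∈ Icc 0 τ := Ico_subset_Icc_self ht
    have hd := ((hφ t (hsub₁ ht')).1.mono hsub₁).sub ((hψ t (hsub₂ ht')).1.mono hsub₂)
    exact hd.mono_of_mem_nhdsWithin 
      (Filter.mem_of_superset (Icc_mem_nhdsGE ht.2) (Icc_subset_Icc_left ht.1))
  have hinner : ∀ t ∈ Icc 0 τ,
      ‖(inner ℂ (w t) (w' t) + inner ℂ (w' t) (w t) : ℂ)‖ ≤
        2 * C₀ a.toNNReal b.toNNReal * ‖(inner ℂ (w t) (w t) : ℂ)‖ := by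
    intro t ht
    obtain ⟨-, h₁, e₁⟩ := hφ t (hsub₁ ht)
    obtain ⟨-, h₂, e₂⟩ := hψ t (hsub₂ ht)
    let u : A.domain := ⟨φ t, h₁⟩ - ⟨ψ t, h₂⟩
    have hu : w t = (u : H) := rfl
    have hw' : w' t = -I • A u + (J (φ t) - J (ψ t)) := by
      simp only [w', e₁, e₂, u, LinearPMap.map_sub]
      module
    have hJ : ‖J (φ t) - J (ψ t)‖ ≤ C₀ a.toNNReal b.toNNReal * ‖w t‖ := by
      refine (hLip₀ ⟨φ t, h₁⟩ ⟨ψ t, h₂⟩).trans ?_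
      gcongr
      · refine NNReal.coe_le_coe.2 (hC₀mono _ _ _ _ ?_ ?_)
        · exact NNReal.le_toNNReal_of_coe_le (ha t ht)
        · exact NNReal.le_toNNReal_of_coe_le (hb t ht)
    have heq : (inner ℂ (w t) (w' t) + inner ℂ (w' t) (w t) : ℂ) =
        inner ℂ (w t) (J (φ t) - J (ψ t)) + inner ℂ (J (φ t) - J (ψ t)) (w t) := by
      have := hsymm u u
      rw [hw', hu]
      simp only [inner_add_left, inner_add_right, inner_smul_left, inner_smul_right, map_neg,
        conj_I, this]
      ring
    have hself : ‖(inner ℂ (w t) (w t) : ℂ)‖ = ‖w t‖ * ‖w t‖ := by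
      rw [inner_self_eq_norm_sq_to_K]
      simp [sq]
    rw [heq, hself]
    calc _ ≤ ‖w t‖ * ‖J (φ t) - J (ψ t)‖ + ‖J (φ t) - J (ψ t)‖ * ‖w t‖ :=
          norm_add_le_of_le (norm_inner_le_norm _ _) (norm_inner_le_norm _ _)
      _ = 2 * ‖w t‖ * ‖J (φ t) - J (ψ t)‖ := by ring
      _ ≤ 2 * ‖w t‖ * (C₀ a.toNNReal b.toNNReal * ‖w t‖) := by gcongr
      _ = _ := by ring
  have hzero := eq_zero_of_abs_deriv_le_mul_abs_self_of_eq_zero_right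
    (f := fun t => (inner ℂ (w t) (w t) : ℂ)) ((hφc.sub hψc).inner (𝕜 := ℂ) (hφc.sub hψc))
    (fun t ht => (hw t ht).inner ℂ (hw t ht)) (by simp [w, hφ0, hψ0])
    (fun t ht => hinner t (Ico_subset_Icc_self ht)) τ (right_mem_Icc.2 hτ.1)
  exact sub_eq_zero.1 (inner_self_eq_zero.1 hzero)

end Uniqueness

/-- Reed–Simon abstract local existence and uniqueness theorem for the
semilinear equation `dφ/dt + i·A·φ = J(φ)` : `A` is a densely defined
self-adjoint operator, `J` maps `D(A)` into itself, `J(0) = 0`, and `J`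
satisfies the two Lipschitz estimates with constants that are monotone
increasing functions of the indicated norms.  Then for every `φ₀ ∈ D(A)` there
is a `T > 0` and a continuously differentiable `D(A)`-valued solution on
`[0,T)` with `φ(0) = φ₀`; and any two such solutions agree on the intersection
of their intervals of existence. -/
theorem local_existence_uniqueness_semilinear
    (A : H →ₗ.[ℂ] H) (hdense : Dense (A.domain : Set H))
    (hsa : A.adjoint = A)
    (J : H → H) (hJdom : ∀ x ∈ A.domain, J x ∈ A.domain) (hJ0 : J 0 = 0)
    (C₀ : NNReal → NNReal → NNReal)
    (hC₀mono : ∀ a b a' b', a ≤ a' → b ≤ b' → C₀ a b ≤ C₀ a' b')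
    (C₁ : NNReal → NNReal → NNReal → NNReal → NNReal)
    (hC₁mono : ∀ a b c d a' b' c' d', a ≤ a' → b ≤ b' → c ≤ c' → d ≤ d' →
      C₁ a b c d ≤ C₁ a' b' c' d')
    (hLip₀ : ∀ φ ψ : A.domain,
      ‖J ↑φ - J ↑ψ‖ ≤ (C₀ ‖(φ : H)‖₊ ‖(ψ : H)‖₊ : ℝ) * ‖(φ : H) - (ψ : H)‖)
    (hLip₁ : ∀ φ ψ : A.domain,
      ‖A ⟨J ↑φ, hJdom _ φ.2⟩ - A ⟨J ↑ψ, hJdom _ ψ.2⟩‖ ≤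
        (C₁ ‖(φ : H)‖₊ ‖A φ‖₊ ‖(ψ : H)‖₊ ‖A ψ‖₊ : ℝ) * ‖A φ - A ψ‖)
    (φ₀ : H) (hφ₀ : φ₀ ∈ A.domain) :
    (∃ T > (0:ℝ), ∃ φ : ℝ → H, IsSolOn A J φ₀ (Ico 0 T) φ) ∧
    (∀ T₁ > (0:ℝ), ∀ T₂ > (0:ℝ), ∀ φ ψ : ℝ → H,
      IsSolOn A J φ₀ (Ico 0 T₁) φ → IsSolOn A J φ₀ (Ico 0 T₂) ψ →
      ∀ t ∈ Ico (0:ℝ) (min T₁ T₂), φ t = ψ t) := by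
  have hsymm := isFormalAdjoint_self hdense hsa
  refine ⟨?_, fun T₁ _ T₂ _ φ ψ hφ hψ => eqOn_of_isSolOn hsymm hC₀mono hLip₀ hφ hψ⟩
  obtain ⟨R, hR, hR', hn, hres, hd⟩ := exists_normal_resolvent hdense hsa
  obtain ⟨U, hU0, hU, hinv, hUc, hUd⟩ := exists_unitary_group hn hres hd
  let D : H →L[ℂ] H := 1 - I • R
  have hmem : ∀ x, R x ∈ A.domain := fun x => LinearPMap.mem_domain_of_mem_graph (hR x)
  have hAR : ∀ x, A ⟨R x, hmem x⟩ = D x := fun x =>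
    ((LinearPMap.image_iff (hmem x)).2 (hR x)).symm
  let K : H → H := fun x => A ⟨J (R x), hJdom _ (hmem x)⟩ + I • J (R x)
  have hRK : ∀ x, R (K x) = J (R x) := fun x => hR' _ (A.mem_graph ⟨J (R x), hJdom _ (hmem x)⟩)
  have hK : ∀ r : NNReal, ∃ L, LipschitzOnWith L K (Metric.closedBall 0 r) := by
    intro r
    have hbound : ∀ S : H →L[ℂ] H, ∀ x ∈ Metric.closedBall (0 : H) r, ‖S x‖₊ ≤ ‖S‖₊ * r :=
      fun S x hx => (S.le_opNNNorm x).trans (by gcongr; exact mem_closedBall_zero_iff.1 hx)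
    refine ⟨C₁ (‖R‖₊ * r) (‖D‖₊ * r) (‖R‖₊ * r) (‖D‖₊ * r) * ‖D‖₊ +
      C₀ (‖R‖₊ * r) (‖R‖₊ * r) * ‖R‖₊, LipschitzOnWith.of_dist_le_mul fun x hx y hy => ?_⟩
    have h₀ := hLip₀ ⟨R x, hmem x⟩ ⟨R y, hmem y⟩
    have h₁ := hLip₁ ⟨R x, hmem x⟩ ⟨R y, hmem y⟩
    rw [hAR, hAR, ← map_sub] at h₁
    rw [← map_sub] at h₀
    have hc₀ := NNReal.coe_le_coe.2 (hC₀mono _ _ _ _ (hbound R x hx) (hbound R y hy))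
    have hc₁ := NNReal.coe_le_coe.2 (hC₁mono _ _ _ _ _ _ _ _ (hbound R x hx) (hbound D x hx)
      (hbound R y hy) (hbound D y hy))
    have h₀' := h₀.trans (mul_le_mul hc₀ (R.le_opNorm _) (norm_nonneg _) NNReal.zero_le_coe)
    have h₁' := h₁.trans (mul_le_mul hc₁ (D.le_opNorm _) (norm_nonneg _) NNReal.zero_le_coe)
    have hsub : K x - K y = (A ⟨J (R x), hJdom _ (hmem x)⟩ - A ⟨J (R y), hJdom _ (hmem y)⟩) +
        I • (J (R x) - J (R y)) := by
      simp only [K]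
      module
    rw [dist_eq_norm, dist_eq_norm, hsub]
    have hI : ‖I • (J (R x) - J (R y))‖ = ‖J (R x) - J (R y)‖ := by
      rw [norm_smul, Complex.norm_I, one_mul]
    refine (norm_add_le_of_le h₁' (hI.trans_le h₀')).trans_eq ?_
    push_cast
    ring
  obtain ⟨T, hT, χ, hχ0, hχc, hχ⟩ := exists_local_solution_of_unitary_group hU0 hU hinv hUc hUd hK
    (A ⟨φ₀, hφ₀⟩ + I • φ₀)
  have hIco : Ico 0 T ⊆ Icc 0 T := Ico_subset_Icc_self
  have hKcont := continuous_of_lipschitzOnWith_closedBall hK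
  refine ⟨T, hT, fun t => R (χ t), ?_, fun t => -I • D (χ t) + R (K (χ t)), ?_, fun t ht =>
    ⟨(hχ t (hIco ht)).mono hIco, hmem _, ?_⟩⟩
  · change R (χ 0) = φ₀
    rw [hχ0]
    exact hR' _ (A.mem_graph ⟨φ₀, hφ₀⟩)
  · have hχc' := hχc.mono hIco
    exact ((D.continuous.comp_continuousOn hχc').const_smul (-I)).add
      (R.continuous.comp_continuousOn (hKcont.comp_continuousOn hχc'))
  · simp only [hAR, hRK]
end

section
/- Let H be a complex Hilbert space and A a densely defined self-adjoint unbounded operator on H with domain D(A). Let J : H → H satisfy J(D(A)) ⊆ D(A), J(0) = 0, and suppose there exist everywhere-finite functions C₀ : ℝ≥0 × ℝ≥0 → ℝ≥0, C₁ : (ℝ≥0)⁴ → ℝ≥0 and C₂ : ℝ≥0 → ℝ≥0, each monotone increasing in each argument, such that for all φ, ψ ∈ D(A): ‖J(φ) − J(ψ)‖ ≤ C₀(‖φ‖, ‖ψ‖)·‖φ − ψ‖, ‖A(J(φ)) − A(J(ψ))‖ ≤ C₁(‖φ‖, ‖Aφ‖, ‖ψ‖, ‖Aψ‖)·‖Aφ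 − Aψ‖, and ‖A(J(φ))‖ ≤ C₂(‖φ‖)·‖Aφ‖. Let φ₀ ∈ D(A) and assume the a priori bound: for every T > 0, every continuously differentiable φ : [0,T) → H with values in D(A) satisfying φ(0) = φ₀ and φ′(t) = −i·A(φ(t)) + J(φ(t)) has sup_{t ∈ [0,T)} ‖φ(t)‖ < ∞. Then there exists a continuously differentiable function φ : [0,∞) → H with φ(t) ∈ D(A) for all t ≥ 0, φ(0) = φ₀ and φ′(t) = −i·A(φ(t)) + J(φ(t)) for all t ≥ 0. -/
open Set Complex

variable {H : Type*} [NormedAddCommGroup H] [InnerProductSpace ℂ H] [CompleteSpace H]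

open Topology Filter
open scoped InnerProductSpace

section ODE

variable {E : Type*} [NormedAddCommGroup E] [NormedSpace ℝ E]

/-- The radial retraction of a normed space onto the closed ball of radius `R` is `2`-Lipschitz. -/
lemma norm_radialRetract_sub_le {R : ℝ} (hR : 0 < R) (x y : E) :
    ‖(R / max R ‖x‖) • x - (R / max R ‖y‖) • y‖ ≤ 2 * ‖x - y‖ := by
  have hx : 0 < max R ‖x‖ := lt_max_of_lt_left hR
  have hy : 0 < max R ‖y‖ := lt_max_of_lt_left hR
  have key : (R / max R ‖x‖) • x - (R / max R ‖y‖) • y =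
      (R / max R ‖x‖) • (x - y) +
        ((R / max R ‖x‖) * ((max R ‖y‖ - max R ‖x‖) / max R ‖y‖)) • y := by
    have : R / max R ‖x‖ - R / max R ‖y‖ =
        (R / max R ‖x‖) * ((max R ‖y‖ - max R ‖x‖) / max R ‖y‖) := by
      field_simp
    rw [← this, smul_sub, sub_smul]
    abel
  have h1 : R / max R ‖x‖ ≤ 1 := (div_le_one hx).2 (le_max_left _ _)
  have h0 : 0 ≤ R / max R ‖x‖ := by positivity
  have h2 : |max R ‖y‖ - max R ‖x‖| ≤ ‖x - y‖ := by
    refine (abs_max_sub_max_le_max R ‖y‖ R ‖x‖).trans ?_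
    rw [sub_self, abs_zero, norm_sub_rev]
    exact max_le (norm_nonneg _) (abs_norm_sub_norm_le y x)
  have h3 : ‖y‖ / max R ‖y‖ ≤ 1 := (div_le_one hy).2 (le_max_right _ _)
  have h4 : |max R ‖y‖ - max R ‖x‖| / max R ‖y‖ * ‖y‖ ≤ ‖x - y‖ := by
    rw [div_mul_eq_mul_div, mul_div_assoc]
    exact (mul_le_of_le_one_right (abs_nonneg _) h3).trans h2
  rw [key, two_mul]
  refine (norm_add_le _ _).trans (add_le_add ?_ ?_)
  · rw [norm_smul, Real.norm_of_nonneg h0]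
    exact mul_le_of_le_one_left (norm_nonneg _) h1
  · rw [norm_smul, norm_mul, Real.norm_of_nonneg h0, norm_div, Real.norm_of_nonneg hy.le,
      Real.norm_eq_abs, mul_assoc]
    exact (mul_le_of_le_one_left (by positivity) h1).trans h4

lemma norm_radialRetract_le {R : ℝ} (hR : 0 < R) (x : E) :
    ‖(R / max R ‖x‖) • x‖ ≤ R := by
  have hx : 0 < max R ‖x‖ := lt_max_of_lt_left hR
  rw [norm_smul, Real.norm_of_nonneg (by positivity), div_mul_eq_mul_div, div_le_iff₀ hx]
  exact mul_le_mul_of_nonneg_left (le_max_right _ _) hR.le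

lemma radialRetract_eq_self {R : ℝ} (hR : 0 < R) {x : E} (hx : ‖x‖ ≤ R) :
    (R / max R ‖x‖) • x = x := by
  rw [max_eq_left hx, div_self hR.ne', one_smul]

lemma IsIntegralCurveOn.eqOn_Icc {v : ℝ → E → E}
    (hv : ∀ R : ℝ, ∃ K : NNReal, ∀ t, LipschitzOnWith K (v t) (Metric.closedBall 0 R))
    {γ δ : ℝ → E} {T : ℝ} (hγ : IsIntegralCurveOn γ v (Icc 0 T))
    (hδ : IsIntegralCurveOn δ v (Icc 0 T)) (h0 : γ 0 = δ 0) : EqOn γ δ (Icc 0 T) := by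
  have hγc : ContinuousOn γ (Icc 0 T) := fun t ht => (hγ t ht).continuousWithinAt
  have hδc : ContinuousOn δ (Icc 0 T) := fun t ht => (hδ t ht).continuousWithinAt
  obtain ⟨R₁, hR₁⟩ := isCompact_Icc.exists_bound_of_continuousOn hγc
  obtain ⟨R₂, hR₂⟩ := isCompact_Icc.exists_bound_of_continuousOn hδc
  obtain ⟨K, hK⟩ := hv (max R₁ R₂)
  have right {f f' : ℝ → E} (h : ∀ t ∈ Icc 0 T, HasDerivWithinAt f (f' t) (Icc 0 T) t) :
      ∀ t ∈ Ico 0 T, HasDerivWithinAt f (f' t) (Ici t) t := fun t ht =>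
    ((h t (Ico_subset_Icc_self ht)).mono (Icc_subset_Icc_left ht.1)).mono_of_mem_nhdsWithin
      (Icc_mem_nhdsGE ht.2)
  refine ODE_solution_unique_of_mem_Icc_right (s := fun _ => Metric.closedBall 0 (max R₁ R₂))
    (fun t _ => hK t) hγc (right hγ) (fun t ht => ?_) hδc (right hδ) (fun t ht => ?_) h0
  · simpa using Or.inl (hR₁ t (Ico_subset_Icc_self ht))
  · simpa using Or.inr (hR₂ t (Ico_subset_Icc_self ht))

/-- Solutions on all compact subintervals glue to a solution on `s`, when `s` has no greatest
element. -/
lemma exists_isIntegralCurveOn_of_Icc {v : ℝ → E → E}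
    (hv : ∀ R : ℝ, ∃ K : NNReal, ∀ t, LipschitzOnWith K (v t) (Metric.closedBall 0 R))
    {x₀ : E} {s : Set ℝ} (hs : ∀ t ∈ s, 0 ≤ t ∧ ∃ b ∈ s, t < b)
    (h : ∀ T ∈ s, ∃ γ : ℝ → E, γ 0 = x₀ ∧ IsIntegralCurveOn γ v (Icc 0 T)) :
    ∃ γ : ℝ → E, (0 ∈ s → γ 0 = x₀) ∧ IsIntegralCurveOn γ v s := by
  classical
  have h' : ∀ t, ∃ b, ∃ γ : ℝ → E, t ∈ s →
      t < b ∧ γ 0 = x₀ ∧ IsIntegralCurveOn γ v (Icc 0 b) := by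
    intro t
    by_cases ht : t ∈ s
    · obtain ⟨b, hb, htb⟩ := (hs t ht).2
      obtain ⟨γ, hγ⟩ := h b hb
      exact ⟨b, γ, fun _ => ⟨htb, hγ⟩⟩
    · exact ⟨0, 0, fun h => absurd h ht⟩
  choose b γ hbγ using h'
  refine ⟨fun t => γ t t, fun h0 => (hbγ 0 h0).2.1, fun t ht => ?_⟩
  obtain ⟨htb, hγ0, hγ⟩ := hbγ t ht
  have heq : ∀ u ∈ s ∩ Iio (b t), γ u u = γ t u := by
    rintro u ⟨hu, hub⟩
    obtain ⟨hub', hγ0', hγ'⟩ := hbγ u hu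
    exact IsIntegralCurveOn.eqOn_Icc hv (T := u)
      (hγ'.mono (Icc_subset_Icc_right hub'.le)) (hγ.mono (Icc_subset_Icc_right (le_of_lt hub)))
      (hγ0'.trans hγ0.symm) ⟨(hs u hu).1, le_rfl⟩
  have hd : HasDerivWithinAt (γ t) (v t (γ t t)) (s ∩ Iio (b t)) t :=
    (hγ t ⟨(hs t ht).1, htb.le⟩).mono fun u hu => ⟨(hs u hu.1).1, le_of_lt hu.2⟩
  exact (hd.congr heq rfl).mono_of_mem_nhdsWithin
    (inter_mem_nhdsWithin _ (Iio_mem_nhds htb))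

variable [CompleteSpace E]

/-- A locally Lipschitz vector field can be truncated to be globally bounded: the truncated
equation is solvable on every compact interval. -/
lemma exists_isIntegralCurveOn_truncation {v : ℝ → E → E} (hvc : ∀ x, Continuous fun t => v t x)
    (hv0 : ∀ t, v t 0 = 0) {R : ℝ} (hR : 0 < R) {K : NNReal}
    (hK : ∀ t, LipschitzOnWith K (v t) (Metric.closedBall 0 R)) (x₀ : E) {T : ℝ} (hT : 0 ≤ T) :
    ∃ γ : ℝ → E, γ 0 = x₀ ∧
      IsIntegralCurveOn γ (fun t x => v t ((R / max R ‖x‖) • x)) (Icc 0 T) := by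
  lift R to NNReal using hR.le
  lift T to NNReal using hT
  have hpl : IsPicardLindelof (fun t x => v t (((R : ℝ) / max (R : ℝ) ‖x‖) • x))
      (⟨0, le_rfl, T.2⟩ : Icc (0 : ℝ) T) x₀ (K * R * T) 0 (K * R) (K * 2) := by
    refine ⟨fun t _ => ?_, fun x _ => (hvc _).continuousOn, fun t _ x _ => ?_, ?_⟩
    · refine LipschitzOnWith.comp (hK t) (LipschitzWith.lipschitzOnWith ?_)
        (fun x _ => by simpa using norm_radialRetract_le hR x)
      exact LipschitzWith.of_dist_le_mul fun x y => by
        simpa [dist_eq_norm] using norm_radialRetract_sub_le hR x y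
    · have h := (hK t).dist_le_mul _ (by simpa using norm_radialRetract_le hR x) 0 (by simp)
      rw [dist_eq_norm, dist_eq_norm, hv0, sub_zero, sub_zero] at h
      push_cast
      exact h.trans (mul_le_mul_of_nonneg_left (norm_radialRetract_le hR x) K.2)
    · simp
  exact hpl.exists_eq_forall_mem_Icc_hasDerivWithinAt₀

/-- Global existence for an ODE with locally Lipschitz right-hand side, all of whose solutions
stay bounded on bounded intervals of existence. -/
theorem exists_isIntegralCurveOn_Ici {v : ℝ → E → E} (hvc : ∀ x, Continuous fun t => v t x)
    (hv0 : ∀ t, v t 0 = 0)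
    (hv : ∀ R : ℝ, ∃ K : NNReal, ∀ t, LipschitzOnWith K (v t) (Metric.closedBall 0 R)) (x₀ : E)
    (hb : ∀ T > 0, ∀ γ : ℝ → E, γ 0 = x₀ → IsIntegralCurveOn γ v (Ico 0 T) →
      ∃ M : ℝ, ∀ t ∈ Ico 0 T, ‖γ t‖ ≤ M) :
    ∃ γ : ℝ → E, γ 0 = x₀ ∧ IsIntegralCurveOn γ v (Ici 0) := by
  set S : Set ℝ := {T | 0 ≤ T ∧ ∃ γ : ℝ → E, γ 0 = x₀ ∧ IsIntegralCurveOn γ v (Icc 0 T)} with hS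
  have hSdown : ∀ T ∈ S, ∀ T', 0 ≤ T' → T' ≤ T → T' ∈ S := fun T ⟨_, γ, h0, h⟩ T' h' hle =>
    ⟨h', γ, h0, h.mono (Icc_subset_Icc_right hle)⟩
  have hS0 : (0 : ℝ) ∈ S := by
    refine ⟨le_rfl, fun t => x₀ + t • v 0 x₀, by simp, fun t ht => ?_⟩
    have ht0 : t = 0 := le_antisymm ht.2 ht.1
    subst ht0
    simpa using (((hasDerivAt_id (0 : ℝ)).smul_const (v 0 x₀)).const_add x₀).hasDerivWithinAt
  -- The set of times up to which a solution exists has no least upper bound.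
  have hext : ∀ T, 0 ≤ T → (∀ t ∈ Ico 0 T, t ∈ S) → ∃ T' > T, T' ∈ S := by
    intro T hT hlt
    obtain ⟨γ, hγ0, hγ, M, hM⟩ : ∃ γ : ℝ → E, (0 < T → γ 0 = x₀) ∧
        IsIntegralCurveOn γ v (Ico 0 T) ∧ ∃ M : ℝ, ∀ t ∈ Ico 0 T, ‖γ t‖ ≤ M := by
      obtain ⟨γ, hγ0, hγ⟩ := exists_isIntegralCurveOn_of_Icc hv (x₀ := x₀) (s := Ico 0 T)
        (fun t ht => ⟨ht.1, (t + T) / 2, ⟨by linarith [ht.1, ht.2], by linarith [ht.2]⟩,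
          by linarith [ht.2]⟩) (fun t ht => (hlt t ht).2)
      rcases hT.eq_or_lt with rfl | hT'
      · exact ⟨γ, fun h => absurd h (lt_irrefl _), hγ, 0, by simp⟩
      · have h0 := hγ0 ⟨le_rfl, hT'⟩
        exact ⟨γ, fun _ => h0, hγ, hb T hT' γ h0 hγ⟩
    set R : ℝ := max (max M ‖x₀‖) 0 + 1 with hRdef
    have hM' : M < R := by
      have := (le_max_left M ‖x₀‖).trans (le_max_left _ (0 : ℝ)); linarith
    have hx' : ‖x₀‖ < R := by
      have := (le_max_right M ‖x₀‖).trans (le_max_left _ (0 : ℝ)); linarith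
    have hR : 0 < R := by
      have := le_max_right (max M ‖x₀‖) (0 : ℝ); linarith
    obtain ⟨K, hK⟩ := hv R
    obtain ⟨δ, hδ0, hδ⟩ := exists_isIntegralCurveOn_truncation hvc hv0 hR hK x₀
      (T := T + 1) (by linarith)
    have hδc : ContinuousOn δ (Icc 0 (T + 1)) := fun t ht => (hδ t ht).continuousWithinAt
    have hwlip : ∀ R' : ℝ, ∃ K : NNReal, ∀ t, LipschitzOnWith K
        (fun x => v t ((R / max R ‖x‖) • x)) (Metric.closedBall 0 R') := fun R' =>
      ⟨K * 2, fun t => LipschitzOnWith.comp (hK t) (LipschitzWith.lipschitzOnWith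
        (LipschitzWith.of_dist_le_mul fun x y => by
          simpa [dist_eq_norm] using norm_radialRetract_sub_le hR x y))
        (fun x _ => by simpa using norm_radialRetract_le hR x)⟩
    have hδM : ∀ t ∈ Ico 0 T, ‖δ t‖ ≤ max M ‖x₀‖ := by
      intro t ht
      have hsub : Icc 0 t ⊆ Ico 0 T := fun u hu => ⟨hu.1, hu.2.trans_lt ht.2⟩
      have : δ t = γ t := by
        refine IsIntegralCurveOn.eqOn_Icc hwlip (T := t)
          (hδ.mono (Icc_subset_Icc_right (by linarith [ht.2]))) (fun u hu => ?_)
          (hδ0.trans (hγ0 (ht.1.trans_lt ht.2)).symm) ⟨ht.1, le_rfl⟩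
        beta_reduce
        rw [radialRetract_eq_self hR ((hM u (hsub hu)).trans hM'.le)]
        exact (hγ u (hsub hu)).mono hsub
      rw [this]
      exact (hM t ht).trans (le_max_left _ _)
    have hδT : ‖δ T‖ < R := by
      rcases hT.eq_or_lt with rfl | hT'
      · rwa [hδ0]
      · have hcl : T ∈ closure (Ico 0 T) := by
          rw [closure_Ico hT'.ne]; exact ⟨hT, le_rfl⟩
        have hle : ‖δ T‖ ≤ max M ‖x₀‖ :=
          ContinuousWithinAt.closure_le hcl
            ((hδc T ⟨hT, by linarith⟩).norm.mono
              fun u hu => ⟨hu.1, by linarith [hu.2]⟩) continuousWithinAt_const hδM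
        exact hle.trans_lt (by have := le_max_left (max M ‖x₀‖) (0 : ℝ); linarith)
    have hev : ∀ᶠ t in 𝓝[Icc 0 (T + 1)] T, ‖δ t‖ < R :=
      (hδc T ⟨hT, by linarith⟩).norm.eventually (gt_mem_nhds hδT)
    obtain ⟨ε, hε, hball⟩ := Metric.mem_nhdsWithin_iff.1 hev
    have hmin : 0 < min (ε / 2) 1 := by positivity
    have hmin1 : min (ε / 2) 1 ≤ ε / 2 := min_le_left _ _
    have hmin2 : min (ε / 2) 1 ≤ 1 := min_le_right _ _
    refine ⟨T + min (ε / 2) 1, by linarith, by linarith, δ, hδ0, fun t ht => ?_⟩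
    have hsub : Icc 0 (T + min (ε / 2) 1) ⊆ Icc 0 (T + 1) := Icc_subset_Icc_right (by linarith)
    have hδR : ‖δ t‖ ≤ R := by
      rcases lt_or_ge t T with h | h
      · exact (hδM t ⟨ht.1, h⟩).trans (by have := le_max_left (max M ‖x₀‖) (0 : ℝ); linarith)
      · refine le_of_lt (hball ⟨?_, hsub ht⟩)
        rw [Metric.mem_ball, Real.dist_eq, abs_of_nonneg (by linarith)]
        linarith [ht.2]
    have := (hδ t (hsub ht)).mono hsub
    beta_reduce at this
    rwa [radialRetract_eq_self hR hδR] at this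
  have hall : ∀ T ∈ Ici (0 : ℝ), T ∈ S := by
    by_contra! hcon
    obtain ⟨T, hT0, hT⟩ := hcon
    have hbdd : BddAbove S := ⟨T, fun t ht => le_of_not_gt fun h => hT (hSdown t ht T hT0 h.le)⟩
    obtain ⟨T', hT', hT'S⟩ := hext (sSup S) (le_csSup hbdd hS0) (fun t ht => by
      obtain ⟨b, hbS, hb⟩ := exists_lt_of_lt_csSup ⟨0, hS0⟩ ht.2
      exact hSdown b hbS t ht.1 hb.le)
    exact absurd (le_csSup hbdd hT'S) (not_le.2 hT')
  obtain ⟨γ, hγ0, hγ⟩ := exists_isIntegralCurveOn_of_Icc hv (x₀ := x₀) (s := Ici 0)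
    (fun t ht => ⟨ht, t + 1, by simpa using (show (0 : ℝ) ≤ t + 1 by linarith [mem_Ici.1 ht]),
      by linarith⟩) (fun T hT => (hall T hT).2)
  exact ⟨γ, hγ0 self_mem_Ici, hγ⟩

end ODE

section UnitaryGroup

lemma norm_exp_skewAdjoint_apply {B : H →L[ℂ] H} (hB : B ∈ skewAdjoint (H →L[ℂ] H)) (t : ℝ)
    (x : H) : ‖NormedSpace.exp (t • B) x‖ = ‖x‖ := by
  let _ : NormedAlgebra ℚ (H →L[ℂ] H) := NormedAlgebra.restrictScalars ℚ ℂ _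
  have hu := NormedSpace.exp_mem_unitary_of_mem_skewAdjoint (skewAdjoint.smul_mem t hB)
  exact ContinuousLinearMap.norm_map_of_mem_unitary hu x

lemma hasDerivAt_exp_smul_apply (B : H →L[ℂ] H) (x : H) (t : ℝ) :
    HasDerivAt (fun s : ℝ => NormedSpace.exp (s • B) x) (NormedSpace.exp (t • B) (B x)) t := by
  have h := hasDerivAt_exp_smul_const (𝕂 := ℝ) B t
  exact ((ContinuousLinearMap.apply ℂ H x).restrictScalars ℝ).hasFDerivAt.comp_hasDerivAt t h

lemma norm_exp_skewAdjoint_apply_sub_le {B : H →L[ℂ] H} (hB : B ∈ skewAdjoint (H →L[ℂ] H))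
    (t : ℝ) (x : H) : ‖NormedSpace.exp (t • B) x - x‖ ≤ |t| * ‖B x‖ := by
  have h := convex_univ.norm_image_sub_le_of_norm_hasDerivWithin_le
    (fun s _ => (hasDerivAt_exp_smul_apply B x s).hasDerivWithinAt)
    (fun s _ => (norm_exp_skewAdjoint_apply hB s (B x)).le) (mem_univ (0 : ℝ)) (mem_univ t)
  simpa [mul_comm] using h

lemma norm_exp_skewAdjoint_sub_exp_le {B C : H →L[ℂ] H} (hB : B ∈ skewAdjoint (H →L[ℂ] H))
    (hC : C ∈ skewAdjoint (H →L[ℂ] H)) (hBC : Commute B C) (t : ℝ) (x : H) :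
    ‖NormedSpace.exp (t • B) x - NormedSpace.exp (t • C) x‖ ≤ |t| * ‖B x - C x‖ := by
  let _ : NormedAlgebra ℚ (H →L[ℂ] H) := NormedAlgebra.restrictScalars ℚ ℂ _
  have hcomm : Commute (t • C) (t • (B - C)) :=
    ((hBC.symm.sub_right (Commute.refl C)).smul_left t).smul_right t
  have hexp : NormedSpace.exp (t • B) =
      NormedSpace.exp (t • C) * NormedSpace.exp (t • (B - C)) := by
    rw [← NormedSpace.exp_add_of_commute hcomm, ← smul_add, add_sub_cancel]
  rw [hexp, mul_apply_eq_comp, ← map_sub, norm_exp_skewAdjoint_apply hC]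
  exact norm_exp_skewAdjoint_apply_sub_le (sub_mem hB hC) t x

/-- If commuting bounded skew-adjoint operators converge pointwise on a dense set, the unitary
groups they generate converge, uniformly on bounded time intervals. -/
lemma exists_tendstoUniformlyOn_exp_skewAdjoint {B : ℕ → H →L[ℂ] H}
    (hB : ∀ n, B n ∈ skewAdjoint (H →L[ℂ] H)) (hcomm : ∀ m n, Commute (B m) (B n))
    {D : Set H} (hD : Dense D) (hlim : ∀ x ∈ D, CauchySeq fun n => B n x) :
    ∃ U : ℝ → H →L[ℂ] H, ∀ x T, TendstoUniformlyOn
      (fun n (t : ℝ) => NormedSpace.exp (t • B n) x) (fun t => U t x) atTop (Ioo (-T) T) := by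
  have hunif : ∀ x T, UniformCauchySeqOn
      (fun n (t : ℝ) => NormedSpace.exp (t • B n) x) atTop (Ioo (-T) T) := by
    intro x T
    refine Metric.uniformCauchySeqOn_iff.2 fun ε hε => ?_
    obtain ⟨d, hd, hdD⟩ := Metric.dense_iff.1 hD x (ε / 4) (by positivity)
    rw [Metric.mem_ball, dist_comm, dist_eq_norm] at hd
    obtain ⟨N, hN⟩ := Metric.cauchySeq_iff.1 (hlim d hdD) (ε / (2 * (|T| + 1))) (by positivity)
    refine ⟨N, fun m hm n hn t ht => ?_⟩
    have htT : |t| ≤ |T| + 1 :=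
      (abs_lt.2 ⟨ht.1, ht.2⟩).le.trans ((le_abs_self T).trans (by linarith))
    have h1 := norm_exp_skewAdjoint_sub_exp_le (hB m) (hB n) (hcomm m n) t d
    have h2 := hN m hm n hn
    rw [dist_eq_norm] at h2
    have h3 : |t| * ‖B m d - B n d‖ ≤ ε / 2 := by
      calc |t| * ‖B m d - B n d‖ ≤ (|T| + 1) * (ε / (2 * (|T| + 1))) := by gcongr
        _ = ε / 2 := by field_simp
    have key : NormedSpace.exp (t • B m) x - NormedSpace.exp (t • B n) x =
        NormedSpace.exp (t • B m) (x - d) - NormedSpace.exp (t • B n) (x - d) +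
          (NormedSpace.exp (t • B m) d - NormedSpace.exp (t • B n) d) := by
      simp only [map_sub]; abel
    have h4 := norm_add_le
      (NormedSpace.exp (t • B m) (x - d) - NormedSpace.exp (t • B n) (x - d))
      (NormedSpace.exp (t • B m) d - NormedSpace.exp (t • B n) d)
    have h5 := norm_sub_le (NormedSpace.exp (t • B m) (x - d)) (NormedSpace.exp (t • B n) (x - d))
    rw [norm_exp_skewAdjoint_apply (hB m), norm_exp_skewAdjoint_apply (hB n)] at h5
    rw [dist_eq_norm, key]
    linarith
  have hmem : ∀ t : ℝ, t ∈ Ioo (-(|t| + 1)) (|t| + 1) := fun t =>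
    ⟨by linarith [neg_abs_le t], by linarith [le_abs_self t]⟩
  have hex : ∀ (t : ℝ) (x : H), ∃ y,
      Tendsto (fun n => NormedSpace.exp (t • B n) x) atTop (𝓝 y) := fun t x =>
    cauchySeq_tendsto_of_complete ((hunif x (|t| + 1)).cauchySeq (hmem t))
  choose f hf using hex
  refine ⟨fun t => continuousLinearMapOfTendsto (fun n => NormedSpace.exp (t • B n))
    (tendsto_pi_nhds.2 (hf t)), fun x T => ?_⟩
  exact (hunif x T).tendstoUniformlyOn_of_tendsto fun t _ => hf t x

/-- Limits of unitary groups with commuting bounded generators. -/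
lemma exists_unitaryGroup_of_approx {B : ℕ → H →L[ℂ] H}
    (hB : ∀ n, B n ∈ skewAdjoint (H →L[ℂ] H)) (hcomm : ∀ m n, Commute (B m) (B n))
    {D : Set H} (hD : Dense D) {L : H → H}
    (hlim : ∀ x ∈ D, Tendsto (fun n => B n x) atTop (𝓝 (L x))) :
    ∃ U : ℝ → H →L[ℂ] H, (∀ t x, ‖U t x‖ = ‖x‖) ∧ (∀ t x, U (-t) (U t x) = x) ∧
      (∀ x, U 0 x = x) ∧ (∀ x, Continuous fun t => U t x) ∧
      (∀ R : H →L[ℂ] H, (∀ n, Commute R (B n)) → ∀ t x, R (U t x) = U t (R x)) ∧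
      ∀ x ∈ D, ∀ t, HasDerivAt (fun s => U s x) (U t (L x)) t := by
  obtain ⟨U, hU⟩ := exists_tendstoUniformlyOn_exp_skewAdjoint hB hcomm hD
    fun x hx => (hlim x hx).cauchySeq
  have hmem : ∀ t : ℝ, t ∈ Ioo (-(|t| + 1)) (|t| + 1) := fun t =>
    ⟨by linarith [neg_abs_le t], by linarith [le_abs_self t]⟩
  have hpt : ∀ (t : ℝ) (x : H),
      Tendsto (fun n => NormedSpace.exp (t • B n) x) atTop (𝓝 (U t x)) := fun t x =>
    (hU x (|t| + 1)).tendsto_at (hmem t)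
  have hiso : ∀ t x, ‖U t x‖ = ‖x‖ := fun t x =>
    tendsto_nhds_unique (hpt t x).norm
      (by simp only [norm_exp_skewAdjoint_apply (hB _)]; exact tendsto_const_nhds)
  have hcont : ∀ x, Continuous fun t => U t x := fun x =>
    continuous_iff_continuousAt.2 fun t =>
      ((hU x (|t| + 1)).continuousOn (Frequently.of_forall fun n =>
        (continuous_iff_continuousAt.2 fun s =>
          (hasDerivAt_exp_smul_apply (B n) x s).continuousAt).continuousOn)).continuousAt
        (isOpen_Ioo.mem_nhds (hmem t))
  refine ⟨U, hiso, fun t x => ?_, fun x => ?_, hcont, fun R hR t x => ?_, fun x hx t => ?_⟩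
  · have h1 : Tendsto (fun n => NormedSpace.exp ((-t) • B n) (U t x)) atTop (𝓝 x) := by
      rw [tendsto_iff_norm_sub_tendsto_zero]
      have h2 := tendsto_iff_norm_sub_tendsto_zero.1 (hpt t x)
      refine h2.congr fun n => ?_
      let _ : NormedAlgebra ℚ (H →L[ℂ] H) := NormedAlgebra.restrictScalars ℚ ℂ _
      have hinv : NormedSpace.exp ((-t) • B n) (NormedSpace.exp (t • B n) x) = x := by
        rw [← mul_apply_eq_comp, ← NormedSpace.exp_add_of_commute
          (((Commute.refl (B n)).smul_left _).smul_right _), ← add_smul]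
        simp
      conv_rhs => rw [← hinv, ← map_sub, norm_exp_skewAdjoint_apply (hB n), hinv]
      exact norm_sub_rev _ _
    exact tendsto_nhds_unique (hpt (-t) (U t x)) h1
  · refine tendsto_nhds_unique (hpt 0 x) ?_
    simp
  · refine tendsto_nhds_unique ((R.continuous.tendsto _).comp (hpt t x)) ?_
    refine (hpt t (R x)).congr fun n => ?_
    let _ : NormedAlgebra ℚ (H →L[ℂ] H) := NormedAlgebra.restrictScalars ℚ ℂ _
    exact (congrArg (fun S : H →L[ℂ] H => S x) ((hR n).smul_right t).exp_right).symm
  · refine hasDerivAt_of_tendstoUniformlyOn (f := fun n (s : ℝ) => NormedSpace.exp (s • B n) x)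
      (f' := fun n s => NormedSpace.exp (s • B n) (B n x)) (g' := fun s => U s (L x))
      (l := atTop) (s := Ioo (-(|t| + 1)) (|t| + 1)) isOpen_Ioo ?_
      (Eventually.of_forall fun n s _ => hasDerivAt_exp_smul_apply (B n) x s)
      (fun s _ => hpt s x) (hmem t)
    refine Metric.tendstoUniformlyOn_iff.2 fun ε hε => ?_
    have h1 := Metric.tendstoUniformlyOn_iff.1 (hU (L x) (|t| + 1)) (ε / 2) (by positivity)
    have h2 := Metric.tendsto_nhds.1 (hlim x hx) (ε / 2) (by positivity)
    filter_upwards [h1, h2] with n h1 h2 s hs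
    refine (dist_triangle _ (NormedSpace.exp (s • B n) (L x)) _).trans_lt ?_
    have h3 : dist (NormedSpace.exp (s • B n) (L x)) (NormedSpace.exp (s • B n) (B n x)) <
        ε / 2 := by
      rwa [dist_eq_norm, ← map_sub, norm_exp_skewAdjoint_apply (hB n), ← dist_eq_norm, dist_comm]
    linarith [h1 s hs]

namespace LinearPMap

variable {A : H →ₗ.[ℂ] H}

lemma inner_snd_fst_eq_of_adjoint_eq (hdense : Dense (A.domain : Set H)) (hsa : A.adjoint = A)
    {g h : H × H} (hg : g ∈ A.graph) (hh : h ∈ A.graph) : ⟪g.2, h.1⟫_ℂ = ⟪g.1, h.2⟫_ℂ := by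
  rw [← hsa, mem_graph_iff] at hg
  rw [mem_graph_iff] at hh
  obtain ⟨x, hx1, hx2⟩ := hg
  obtain ⟨y, hy1, hy2⟩ := hh
  rw [← hx1, ← hx2, ← hy1, ← hy2]
  exact adjoint_isFormalAdjoint hdense x y

lemma mem_graph_of_forall_inner_eq (hdense : Dense (A.domain : Set H)) (hsa : A.adjoint = A)
    {y w : H} (h : ∀ g ∈ A.graph, ⟪w, g.1⟫_ℂ = ⟪y, g.2⟫_ℂ) : (y, w) ∈ A.graph := by
  have h' : ∀ x : A.domain, ⟪w, (x : H)⟫_ℂ = ⟪y, A x⟫_ℂ := fun x => h _ (A.mem_graph x)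
  have hy : y ∈ A.adjoint.domain := mem_adjoint_domain_of_exists y ⟨w, h'⟩
  rw [← hsa, mem_graph_iff]
  exact ⟨⟨y, hy⟩, rfl, adjoint_apply_eq hdense ⟨y, hy⟩ h'⟩

lemma norm_sq_fst_add_smul_snd (hdense : Dense (A.domain : Set H)) (hsa : A.adjoint = A) (r : ℝ)
    {g : H × H} (hg : g ∈ A.graph) :
    ‖g.1 + (I * r) • g.2‖ ^ 2 = ‖g.1‖ ^ 2 + r ^ 2 * ‖g.2‖ ^ 2 := by
  have him : (⟪g.1, g.2⟫_ℂ).im = 0 := by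
    have h := inner_snd_fst_eq_of_adjoint_eq hdense hsa hg hg
    rw [← inner_conj_symm] at h
    exact Complex.conj_eq_iff_im.1 h
  rw [norm_add_sq (𝕜 := ℂ), inner_smul_right, norm_smul, norm_mul, norm_I, one_mul,
    Complex.norm_real, mul_pow, Real.norm_eq_abs, sq_abs]
  simp [him]

lemma norm_fst_le (hdense : Dense (A.domain : Set H)) (hsa : A.adjoint = A) (r : ℝ)
    {g : H × H} (hg : g ∈ A.graph) : ‖g.1‖ ≤ ‖g.1 + (I * r) • g.2‖ := by
  refine le_of_sq_le_sq ?_ (norm_nonneg _)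
  rw [norm_sq_fst_add_smul_snd hdense hsa r hg]
  exact le_add_of_nonneg_right (by positivity)

lemma abs_mul_norm_snd_le (hdense : Dense (A.domain : Set H)) (hsa : A.adjoint = A) (r : ℝ)
    {g : H × H} (hg : g ∈ A.graph) : |r| * ‖g.2‖ ≤ ‖g.1 + (I * r) • g.2‖ := by
  refine le_of_sq_le_sq ?_ (norm_nonneg _)
  rw [norm_sq_fst_add_smul_snd hdense hsa r hg, mul_pow, sq_abs]
  exact le_add_of_nonneg_left (by positivity)

lemma completeSpace_graph (hdense : Dense (A.domain : Set H)) (hsa : A.adjoint = A) :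
    CompleteSpace A.graph := by
  have h : _root_.IsClosed (A.graph : Set (H × H)) := hsa ▸ adjoint_isClosed hdense
  exact h.isComplete.completeSpace_coe

/-- `1 + i r A` has a bounded inverse, a contraction. -/
lemma exists_resolvent (hdense : Dense (A.domain : Set H)) (hsa : A.adjoint = A) {r : ℝ}
    (hr : r ≠ 0) : ∃ R : H →L[ℂ] H, (∀ y, ∃ z, (R y, z) ∈ A.graph ∧ R y + (I * r) • z = y) ∧
      (∀ x z, (x, z) ∈ A.graph → R (x + (I * r) • z) = x) ∧ ∀ y, ‖R y‖ ≤ ‖y‖ := by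
  have := completeSpace_graph hdense hsa
  set T : A.graph →L[ℂ] H := (ContinuousLinearMap.fst ℂ H H).comp A.graph.subtypeL +
    (I * r : ℂ) • (ContinuousLinearMap.snd ℂ H H).comp A.graph.subtypeL with hT
  have hTa : ∀ g : A.graph, T g = g.1.1 + (I * r) • g.1.2 := fun g => by simp [hT]
  have hr' : 0 < |r| := abs_pos.2 hr
  have hanti : AntilipschitzWith (max 1 ⟨|r|⁻¹, by positivity⟩) T := by
    refine ContinuousLinearMap.antilipschitz_of_bound T fun g => ?_
    have h1 := norm_fst_le hdense hsa r g.2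
    have h2 := abs_mul_norm_snd_le hdense hsa r g.2
    rw [← hTa] at h1 h2
    rw [Submodule.coe_norm, Prod.norm_def]
    refine max_le ?_ ?_
    · exact h1.trans (le_mul_of_one_le_left (norm_nonneg _) (le_max_left _ _))
    · have h3 : ‖g.1.2‖ ≤ |r|⁻¹ * ‖T g‖ := by
        rw [← div_eq_inv_mul, le_div_iff₀ hr', mul_comm]
        exact h2
      exact h3.trans (mul_le_mul_of_nonneg_right (le_max_right _ _) (norm_nonneg _))
  have hker : T.ker = ⊥ := LinearMap.ker_eq_bot.2 hanti.injective
  have hclosed : _root_.IsClosed (T.range : Set H) := by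
    rw [LinearMap.coe_range]
    exact hanti.isClosed_range T.uniformContinuous
  have hrange : T.range = ⊤ := by
    have := hclosed.isComplete.completeSpace_coe
    rw [← Submodule.orthogonal_eq_bot_iff, Submodule.eq_bot_iff]
    intro y hy
    have hy' : ∀ g ∈ A.graph, ⟪y, g.1 + (I * r) • g.2⟫_ℂ = 0 := fun g hg => by
      have h : ⟪T ⟨g, hg⟩, y⟫_ℂ = 0 := (Submodule.mem_orthogonal _ _).1 hy _ ⟨_, rfl⟩
      rw [← inner_conj_symm, ← hTa ⟨g, hg⟩, h, _root_.map_zero]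
    have hne : (I * r : ℂ) ≠ 0 := mul_ne_zero I_ne_zero (ofReal_ne_zero.2 hr)
    have hyw : (y, (I * r : ℂ)⁻¹ • y) ∈ A.graph :=
      mem_graph_of_forall_inner_eq hdense hsa fun g hg => by
        have h := hy' g hg
        have hr'' : (r : ℂ) ≠ 0 := ofReal_ne_zero.2 hr
        rw [inner_add_right, inner_smul_right] at h
        rw [inner_smul_left, map_inv₀, map_mul, conj_I, conj_ofReal]
        field_simp
        linear_combination -h
    have h := hy' _ hyw
    rw [smul_inv_smul₀ hne, ← two_smul ℂ y, inner_smul_right] at h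
    exact inner_self_eq_zero.1 ((mul_eq_zero.1 h).resolve_left two_ne_zero)
  let e := ContinuousLinearEquiv.ofBijective T hker hrange
  have he : ∀ g, e g = T g := fun g => rfl
  refine ⟨(ContinuousLinearMap.fst ℂ H H).comp (A.graph.subtypeL.comp e.symm.toContinuousLinearMap),
    fun y => ⟨(e.symm y).1.2, (e.symm y).2, ?_⟩, fun x z hxz => ?_, fun y => ?_⟩
  · have := e.apply_symm_apply y
    rwa [he, hTa] at this
  · have : e.symm (x + (I * r) • z) = ⟨(x, z), hxz⟩ := by
      rw [ContinuousLinearEquiv.symm_apply_eq, he, hTa]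
    simp [this]
  · have h := norm_fst_le hdense hsa r (e.symm y).2
    rw [← hTa, ← he, e.apply_symm_apply] at h
    exact h

/-- Stone's theorem (existence part): `-iA` generates a strongly continuous unitary group. -/
theorem exists_unitaryGroup (hdense : Dense (A.domain : Set H)) (hsa : A.adjoint = A) :
    ∃ U : ℝ → H →L[ℂ] H, (∀ t x, ‖U t x‖ = ‖x‖) ∧ (∀ t x, U (-t) (U t x) = x) ∧
      (∀ x, U 0 x = x) ∧ (∀ x, Continuous fun t => U t x) ∧
      ∀ x z, (x, z) ∈ A.graph → ∀ t, (U t x, U t z) ∈ A.graph ∧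
        HasDerivAt (fun s => U s x) ((-I) • U t z) t := by
  have hex : ∀ r : ℝ, ∃ R : H →L[ℂ] H, r ≠ 0 →
      (∀ y, ∃ z, (R y, z) ∈ A.graph ∧ R y + (I * r) • z = y) ∧
      (∀ x z, (x, z) ∈ A.graph → R (x + (I * r) • z) = x) ∧ ∀ y, ‖R y‖ ≤ ‖y‖ := fun r => by
    by_cases hr : r = 0
    · exact ⟨0, fun h => absurd hr h⟩
    · obtain ⟨R, hR⟩ := exists_resolvent hdense hsa hr
      exact ⟨R, fun _ => hR⟩
  choose R hR using hex
  have hgraph : ∀ {r : ℝ}, r ≠ 0 → ∀ {x z}, (x, z) ∈ A.graph → (R r x, R r z) ∈ A.graph := by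
    intro r hr x z hxz
    have hIr : (I * r : ℂ) ≠ 0 := mul_ne_zero I_ne_zero (ofReal_ne_zero.2 hr)
    obtain ⟨w, hw, hwx⟩ := (hR r hr).1 x
    have h := (hR r hr).2.1 x z hxz
    rw [_root_.map_add, _root_.map_smul] at h
    have hwz : (I * r : ℂ) • w = (I * r : ℂ) • R r z := add_left_cancel (hwx.trans h.symm)
    rwa [smul_right_injective H hIr hwz] at hw
  have hcommR : ∀ {r s : ℝ}, r ≠ 0 → s ≠ 0 → Commute (R r) (R s) := by
    intro r s hr hs
    refine ContinuousLinearMap.ext fun x => ?_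
    obtain ⟨z, hz, hzx⟩ := (hR s hs).1 x
    have h := (hR s hs).2.1 _ _ (hgraph hr hz)
    rw [← _root_.map_smul, ← _root_.map_add, hzx] at h
    exact h.symm
  have hadj : ∀ {r : ℝ}, r ≠ 0 → star (R r) = R (-r) := by
    intro r hr
    rw [ContinuousLinearMap.star_eq_adjoint, eq_comm, ContinuousLinearMap.eq_adjoint_iff]
    intro x y
    obtain ⟨z, hz, hzx⟩ := (hR (-r) (neg_ne_zero.2 hr)).1 x
    obtain ⟨w, hw, hwy⟩ := (hR r hr).1 y
    have h := inner_snd_fst_eq_of_adjoint_eq hdense hsa hz hw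
    simp only at h
    conv_lhs => rw [← hwy]
    conv_rhs => rw [← hzx]
    rw [inner_add_left, inner_add_right, inner_smul_left, inner_smul_right, h]
    simp
  have hRlim : ∀ {ρ : ℕ → ℝ}, (∀ n, ρ n ≠ 0) → Tendsto ρ atTop (𝓝 0) → ∀ y,
      Tendsto (fun n => R (ρ n) y) atTop (𝓝 y) := by
    intro ρ hρ hρ0 y
    refine Metric.tendsto_nhds.2 fun ε hε => ?_
    obtain ⟨d, hd, hdD⟩ := Metric.dense_iff.1 hdense y (ε / 3) (by positivity)
    rw [Metric.mem_ball, dist_eq_norm] at hd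
    obtain ⟨w, hw⟩ := mem_domain_iff.1 hdD
    have h1 : Tendsto (fun n => |ρ n| * ‖w‖) atTop (𝓝 0) := by
      simpa using hρ0.abs.mul_const ‖w‖
    filter_upwards [h1.eventually (gt_mem_nhds (show 0 < ε / 3 by positivity))] with n hn
    have h2 : d - R (ρ n) d = (I * ρ n) • R (ρ n) w := by
      have h := (hR _ (hρ n)).2.1 d w hw
      rw [_root_.map_add, _root_.map_smul] at h
      rw [sub_eq_iff_eq_add', h]
    have h3 : ‖d - R (ρ n) d‖ < ε / 3 := by
      rw [h2, norm_smul, norm_mul, norm_I, one_mul, norm_real, Real.norm_eq_abs]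
      exact (mul_le_mul_of_nonneg_left ((hR _ (hρ n)).2.2 w) (abs_nonneg _)).trans_lt hn
    have h4 : ‖R (ρ n) (d - y)‖ < ε / 3 := ((hR _ (hρ n)).2.2 _).trans_lt hd
    have key : y - R (ρ n) y = R (ρ n) (d - y) - (d - y) + (d - R (ρ n) d) := by
      rw [_root_.map_sub]; abel
    rw [dist_comm, dist_eq_norm, key]
    have h5 := norm_add_le (R (ρ n) (d - y) - (d - y)) (d - R (ρ n) d)
    have h6 := norm_sub_le (R (ρ n) (d - y)) (d - y)
    linarith
  set ρ : ℕ → ℝ := fun n => 1 / ((n : ℝ) + 1) with hρ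
  have hρ0 : ∀ n, ρ n ≠ 0 := fun n => by positivity
  have hρlim : Tendsto ρ atTop (𝓝 0) := tendsto_one_div_add_atTop_nhds_zero_nat
  set B : ℕ → H →L[ℂ] H := fun n => (2 * ρ n)⁻¹ • (R (ρ n) - R (-ρ n)) with hB
  have hneg : ∀ n, -ρ n ≠ 0 := fun n => neg_ne_zero.2 (hρ0 n)
  have hBskew : ∀ n, B n ∈ skewAdjoint (H →L[ℂ] H) := fun n => by
    refine skewAdjoint.smul_mem _ (skewAdjoint.mem_iff.2 ?_)
    rw [star_sub, hadj (hρ0 n), hadj (hneg n), neg_neg, neg_sub]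
  have hRB : ∀ {r}, r ≠ 0 → ∀ n, Commute (R r) (B n) := fun hr n =>
    ((hcommR hr (hρ0 n)).sub_right (hcommR hr (hneg n))).smul_right _
  have hBB : ∀ m n, Commute (B m) (B n) := fun m n =>
    ((hRB (hρ0 m) n).sub_left (hRB (hneg m) n)).smul_left _
  have hBlim : ∀ {x z}, (x, z) ∈ A.graph → Tendsto (fun n => B n x) atTop (𝓝 ((-I) • z)) := by
    intro x z hxz
    have h := (((hRlim hρ0 hρlim z).add (hRlim hneg (by simpa using hρlim.neg) z)).const_smul
      (-I / 2 : ℂ))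
    have hz : (-I / 2 : ℂ) • (z + z) = (-I) • z := by
      rw [← two_smul ℂ z, smul_smul]; congr 1; ring
    rw [hz] at h
    refine h.congr fun n => ?_
    have h1 := (hR _ (hρ0 n)).2.1 x z hxz
    have h2 := (hR _ (hneg n)).2.1 x z hxz
    rw [_root_.map_add, _root_.map_smul] at h1 h2
    have h3 : R (ρ n) x - R (-ρ n) x = (-(I * ρ n)) • (R (ρ n) z + R (-ρ n) z) := by
      rw [← eq_sub_iff_add_eq] at h1 h2
      rw [h1, h2]
      push_cast
      module
    have h4 : B n x = ((2 * ρ n)⁻¹ : ℝ) • (R (ρ n) x - R (-ρ n) x) := rfl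
    have hρc : (ρ n : ℂ) ≠ 0 := ofReal_ne_zero.2 (hρ0 n)
    rw [h4, h3, ← Complex.coe_smul, smul_smul]
    congr 1
    push_cast
    field_simp
  classical
  obtain ⟨U, hiso, hinv, hzero, hcont, hcommU, hderiv⟩ := exists_unitaryGroup_of_approx hBskew hBB
    hdense (L := fun x => if h : x ∈ A.domain then (-I) • A ⟨x, h⟩ else 0)
    (fun x hx => by rw [dif_pos (SetLike.mem_coe.1 hx)]; exact hBlim (A.mem_graph ⟨x, hx⟩))
  refine ⟨U, hiso, hinv, hzero, hcont, fun x z hxz t => ⟨?_, ?_⟩⟩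
  · obtain ⟨w, hw, hwx⟩ := (hR 1 one_ne_zero).1 (U t (x + (I * (1 : ℝ)) • z))
    rw [hcommU _ (hRB one_ne_zero), (hR 1 one_ne_zero).2.1 x z hxz] at hw hwx
    rw [_root_.map_add, _root_.map_smul] at hwx
    have hI : (I * (1 : ℝ) : ℂ) ≠ 0 := by simp
    rwa [smul_right_injective H hI (add_left_cancel hwx)] at hw
  · have hx : x ∈ A.domain := mem_domain_of_mem_graph hxz
    have h := hderiv x hx t
    have hAx : A ⟨x, hx⟩ = z := mem_graph_snd_inj A (A.mem_graph ⟨x, hx⟩) hxz rfl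
    rwa [dif_pos hx, hAx, _root_.map_smul] at h

end LinearPMap

end UnitaryGroup

section Semilinear

lemma continuous_uncurry_of_isometry {E F : Type*} [PseudoMetricSpace E] [PseudoMetricSpace F]
    {V : ℝ → E → F} (hiso : ∀ t, Isometry (V t)) (hcont : ∀ x, Continuous fun t => V t x) :
    Continuous fun q : ℝ × E => V q.1 q.2 := by
  have h := continuous_prod_of_continuous_lipschitzWith (fun q : E × ℝ => V q.2 q.1) 1 hcont
    fun t => (hiso t).lipschitz
  exact h.comp continuous_swap

omit [CompleteSpace H] in
lemma hasDerivWithinAt_isometry_apply {U : ℝ → H →L[ℂ] H} (hiso : ∀ t x, ‖U t x‖ = ‖x‖)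
    (hcont : ∀ x, Continuous fun t => U t x) {p : ℝ → H} {p' d : H} {s : Set ℝ} {t : ℝ}
    (hp : HasDerivWithinAt p p' s t) (hd : HasDerivAt (fun τ => U τ (p t)) d t) :
    HasDerivWithinAt (fun τ => U τ (p τ)) (d + U t p') s t := by
  have hUc : Continuous fun q : ℝ × H => U q.1 q.2 :=
    continuous_uncurry_of_isometry (V := fun t x => U t x)
      (fun t => AddMonoidHomClass.isometry_of_norm (U t) (hiso t)) hcont
  have h1 : HasDerivWithinAt (fun τ => U τ (p τ - p t)) (U t p') s t := by
    rw [hasDerivWithinAt_iff_tendsto_slope] at hp ⊢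
    have ht : Tendsto (fun τ : ℝ => τ) (𝓝[s \ {t}] t) (𝓝 t) := tendsto_id.mono_left inf_le_left
    refine ((hUc.tendsto (t, p')).comp (ht.prodMk_nhds hp)).congr fun τ => ?_
    simp [slope_def_module, ContinuousLinearMap.map_smul_of_tower]
  convert hd.hasDerivWithinAt.add h1 using 1
  ext τ
  simp

variable {A : H →ₗ.[ℂ] H}

omit [CompleteSpace H] in
lemma exists_graph_nonlinearity {J : H → H} (hJdom : ∀ x ∈ A.domain, J x ∈ A.domain)
    (hJ0 : J 0 = 0) {C₀ : NNReal → NNReal → NNReal}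
    (hC₀mono : ∀ a b a' b', a ≤ a' → b ≤ b' → C₀ a b ≤ C₀ a' b')
    {C₁ : NNReal → NNReal → NNReal → NNReal → NNReal}
    (hC₁mono : ∀ a b c d a' b' c' d', a ≤ a' → b ≤ b' → c ≤ c' → d ≤ d' →
      C₁ a b c d ≤ C₁ a' b' c' d')
    (hLip₀ : ∀ φ ψ : A.domain,
      ‖J ↑φ - J ↑ψ‖ ≤ (C₀ ‖(φ : H)‖₊ ‖(ψ : H)‖₊ : ℝ) * ‖(φ : H) - (ψ : H)‖)
    (hLip₁ : ∀ φ ψ : A.domain,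
      ‖A ⟨J ↑φ, hJdom _ φ.2⟩ - A ⟨J ↑ψ, hJdom _ ψ.2⟩‖ ≤
        (C₁ ‖(φ : H)‖₊ ‖A φ‖₊ ‖(ψ : H)‖₊ ‖A ψ‖₊ : ℝ) * ‖A φ - A ψ‖) :
    ∃ N : A.graph → A.graph, N 0 = 0 ∧ (∀ g, (N g).1.1 = J g.1.1) ∧
      ∀ R : ℝ, ∃ K : NNReal, LipschitzOnWith K N (Metric.closedBall 0 R) := by
  have hmem : ∀ g : A.graph, g.1.1 ∈ A.domain := fun g => LinearPMap.mem_domain_of_mem_graph g.2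
  have hA : ∀ g : A.graph, A ⟨g.1.1, hmem g⟩ = g.1.2 := fun g =>
    A.mem_graph_snd_inj (A.mem_graph ⟨g.1.1, hmem g⟩) g.2 rfl
  refine ⟨fun g => ⟨(J g.1.1, A ⟨J g.1.1, hJdom _ (hmem g)⟩), A.mem_graph ⟨J g.1.1, _⟩⟩, ?_,
    fun g => rfl, fun R => ?_⟩
  · refine Subtype.ext (Prod.ext hJ0 ?_)
    exact A.graph_fst_eq_zero_snd (A.mem_graph ⟨J 0, hJdom _ A.domain.zero_mem⟩) hJ0
  · set S := R.toNNReal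
    refine ⟨max (C₀ S S) (C₁ S S S S), LipschitzOnWith.of_dist_le_mul fun g hg h hh => ?_⟩
    have hb : ∀ g ∈ Metric.closedBall (0 : A.graph) R, ‖g.1.1‖₊ ≤ S ∧ ‖g.1.2‖₊ ≤ S := by
      intro g hg
      rw [mem_closedBall_zero_iff, Submodule.coe_norm] at hg
      exact ⟨NNReal.coe_le_coe.1 (((norm_fst_le g.1).trans hg).trans R.le_coe_toNNReal),
        NNReal.coe_le_coe.1 (((norm_snd_le g.1).trans hg).trans R.le_coe_toNNReal)⟩
    obtain ⟨hg1, hg2⟩ := hb g hg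
    obtain ⟨hh1, hh2⟩ := hb h hh
    have h0 := hLip₀ ⟨g.1.1, hmem g⟩ ⟨h.1.1, hmem h⟩
    have h1 := hLip₁ ⟨g.1.1, hmem g⟩ ⟨h.1.1, hmem h⟩
    rw [hA, hA] at h1
    rw [Subtype.dist_eq, Subtype.dist_eq, dist_eq_norm, dist_eq_norm]
    rw [Prod.norm_def]
    refine max_le (h0.trans ?_) (h1.trans ?_)
    · refine mul_le_mul (NNReal.coe_le_coe.2 ?_) (norm_fst_le (g.1 - h.1)) (norm_nonneg _)
        (NNReal.coe_nonneg _)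
      exact (hC₀mono _ _ _ _ hg1 hh1).trans (le_max_left _ _)
    · refine mul_le_mul (NNReal.coe_le_coe.2 ?_) (norm_snd_le (g.1 - h.1)) (norm_nonneg _)
        (NNReal.coe_nonneg _)
      exact (hC₁mono _ _ _ _ _ _ _ _ hg1 hg2 hh1 hh2).trans (le_max_right _ _)

omit [CompleteSpace H] in
lemma isSolOn_of_isIntegralCurveOn {U : ℝ → H →L[ℂ] H} (hiso : ∀ t x, ‖U t x‖ = ‖x‖)
    (hzero : ∀ x, U 0 x = x) (hcont : ∀ x, Continuous fun t => U t x)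
    (hU : ∀ x z, (x, z) ∈ A.graph → ∀ t, (U t x, U t z) ∈ A.graph ∧
      HasDerivAt (fun s => U s x) ((-I) • U t z) t)
    {J : H → H} {F : ℝ → A.graph → A.graph} (hF : Continuous fun q : ℝ × A.graph => F q.1 q.2)
    (hFJ : ∀ t g, U t (F t g).1.1 = J (U t g.1.1)) {ψ : ℝ → A.graph} {s : Set ℝ}
    (hψ : IsIntegralCurveOn ψ F s) : IsSolOn A J (ψ 0).1.1 s fun t => U t (ψ t).1.1 := by
  have hUc : Continuous fun q : ℝ × H => U q.1 q.2 :=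
    continuous_uncurry_of_isometry (V := fun t x => U t x)
      (fun t => AddMonoidHomClass.isometry_of_norm (U t) (hiso t)) hcont
  have hψc : ContinuousOn ψ s := fun t ht => (hψ t ht).continuousWithinAt
  have hFc : ContinuousOn (fun t => F t (ψ t)) s :=
    hF.comp_continuousOn (continuousOn_id.prodMk hψc)
  refine ⟨hzero _, fun t => (-I) • U t (ψ t).1.2 + U t (F t (ψ t)).1.1, ?_, fun t ht => ⟨?_, ?_⟩⟩
  · refine ContinuousOn.add (ContinuousOn.const_smul ?_ _) ?_
    · exact hUc.comp_continuousOn (continuousOn_id.prodMk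
        (continuous_snd.comp_continuousOn (continuous_subtype_val.comp_continuousOn hψc)))
    · exact hUc.comp_continuousOn (continuousOn_id.prodMk
        (continuous_fst.comp_continuousOn (continuous_subtype_val.comp_continuousOn hFc)))
  · refine hasDerivWithinAt_isometry_apply hiso hcont ?_ (hU _ _ (ψ t).2 t).2
    exact ((ContinuousLinearMap.fst ℂ H H).comp
      A.graph.subtypeL |>.restrictScalars ℝ).hasFDerivAt.comp_hasDerivWithinAt t (hψ t ht)
  · have hg := (hU _ _ (ψ t).2 t).1
    have hdom := LinearPMap.mem_domain_of_mem_graph hg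
    refine ⟨hdom, ?_⟩
    beta_reduce
    rw [hFJ, A.mem_graph_snd_inj (A.mem_graph ⟨_, hdom⟩) hg rfl]

end Semilinear

/-- Reed–Simon abstract global existence theorem (case `n = 1`) for the
semilinear equation `dφ/dt + i·A·φ = J(φ)` : `A` is densely defined and
self-adjoint, `J` preserves `D(A)`, `J(0) = 0`, satisfies the two Lipschitz
estimates and the linear bound `‖A J(φ)‖ ≤ C₂(‖φ‖)·‖Aφ‖`, and every solution
issued from `φ₀` on a finite interval of existence stays bounded in norm.
Then there is a continuously differentiable `D(A)`-valued solution on all of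
`[0, ∞)` with `φ(0) = φ₀`. -/
theorem global_existence_semilinear
    (A : H →ₗ.[ℂ] H) (hdense : Dense (A.domain : Set H))
    (hsa : A.adjoint = A)
    (J : H → H) (hJdom : ∀ x ∈ A.domain, J x ∈ A.domain) (hJ0 : J 0 = 0)
    (C₀ : NNReal → NNReal → NNReal)
    (hC₀mono : ∀ a b a' b', a ≤ a' → b ≤ b' → C₀ a b ≤ C₀ a' b')
    (C₁ : NNReal → NNReal → NNReal → NNReal → NNReal)
    (hC₁mono : ∀ a b c d a' b' c' d', a ≤ a' → b ≤ b' → c ≤ c' → d ≤ d' →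
      C₁ a b c d ≤ C₁ a' b' c' d')
    (C₂ : NNReal → NNReal) (hC₂mono : Monotone C₂)
    (hLip₀ : ∀ φ ψ : A.domain,
      ‖J ↑φ - J ↑ψ‖ ≤ (C₀ ‖(φ : H)‖₊ ‖(ψ : H)‖₊ : ℝ) * ‖(φ : H) - (ψ : H)‖)
    (hLip₁ : ∀ φ ψ : A.domain,
      ‖A ⟨J ↑φ, hJdom _ φ.2⟩ - A ⟨J ↑ψ, hJdom _ ψ.2⟩‖ ≤
        (C₁ ‖(φ : H)‖₊ ‖A φ‖₊ ‖(ψ : H)‖₊ ‖A ψ‖₊ : ℝ) * ‖A φ - A ψ‖)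
    (hBnd : ∀ φ : A.domain, ‖A ⟨J ↑φ, hJdom _ φ.2⟩‖ ≤ (C₂ ‖(φ : H)‖₊ : ℝ) * ‖A φ‖)
    (φ₀ : H) (hφ₀ : φ₀ ∈ A.domain)
    (hapriori : ∀ T > (0:ℝ), ∀ φ : ℝ → H, IsSolOn A J φ₀ (Ico 0 T) φ →
      ∃ M : ℝ, ∀ t ∈ Ico (0:ℝ) T, ‖φ t‖ ≤ M) :
    ∃ φ : ℝ → H, IsSolOn A J φ₀ (Ici 0) φ := by
  obtain ⟨U, hiso, hinv, hzero, hcont, hU⟩ := A.exists_unitaryGroup hdense hsa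
  obtain ⟨N, hN0, hNJ, hNlip⟩ := exists_graph_nonlinearity hJdom hJ0 hC₀mono hC₁mono hLip₀ hLip₁
  have := LinearPMap.completeSpace_graph hdense hsa
  have hinv' : ∀ t x, U t (U (-t) x) = x := fun t x => by simpa using hinv (-t) x
  let V : ℝ → A.graph → A.graph := fun t g => ⟨(U t g.1.1, U t g.1.2), (hU _ _ g.2 t).1⟩
  have hVnorm : ∀ t g, ‖V t g‖ = ‖g‖ := fun t g => by
    change max ‖U t g.1.1‖ ‖U t g.1.2‖ = max ‖g.1.1‖ ‖g.1.2‖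
    rw [hiso, hiso]
  have hVsub : ∀ t g h, V t g - V t h = V t (g - h) := fun t g h =>
    Subtype.ext (Prod.ext (map_sub (U t) _ _).symm (map_sub (U t) _ _).symm)
  have hV0 : ∀ t, V t 0 = 0 := fun t =>
    Subtype.ext (Prod.ext (map_zero (U t)) (map_zero (U t)))
  have hViso : ∀ t, Isometry (V t) := fun t => Isometry.of_dist_eq fun g h => by
    rw [dist_eq_norm, dist_eq_norm, hVsub, hVnorm]
  have hVcont : Continuous fun q : ℝ × A.graph => V q.1 q.2 :=
    continuous_uncurry_of_isometry hViso fun g =>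
      Continuous.subtype_mk ((hcont _).prodMk (hcont _)) _
  have hNcont : Continuous N := continuous_iff_continuousAt.2 fun g => by
    obtain ⟨K, hK⟩ := hNlip (‖g‖ + 1)
    refine hK.continuousOn.continuousAt (Filter.mem_of_superset
      (Metric.ball_mem_nhds g one_pos) fun h hh => ?_)
    rw [mem_ball_iff_norm] at hh
    rw [mem_closedBall_zero_iff]
    linarith [norm_le_insert' h g]
  let F : ℝ → A.graph → A.graph := fun t g => V (-t) (N (V t g))
  have hF : Continuous fun q : ℝ × A.graph => F q.1 q.2 :=
    hVcont.comp (continuous_fst.neg.prodMk (hNcont.comp hVcont))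
  have hFJ : ∀ t g, U t (F t g).1.1 = J (U t g.1.1) := fun t g =>
    (hinv' t _).trans (hNJ (V t g))
  have hFlip : ∀ R : ℝ, ∃ K : NNReal, ∀ t, LipschitzOnWith K (F t) (Metric.closedBall 0 R) := by
    intro R
    obtain ⟨K, hK⟩ := hNlip R
    refine ⟨K, fun t => LipschitzOnWith.of_dist_le_mul fun g hg h hh => ?_⟩
    rw [(hViso (-t)).dist_eq, ← (hViso t).dist_eq g h]
    refine hK.dist_le_mul _ ?_ _ ?_
    · rwa [mem_closedBall_zero_iff, hVnorm, ← mem_closedBall_zero_iff]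
    · rwa [mem_closedBall_zero_iff, hVnorm, ← mem_closedBall_zero_iff]
  have hFbnd : ∀ t g, ‖(F t g).1.2‖ ≤ C₂ ‖g.1.1‖₊ * ‖g.1.2‖ := fun t g => by
    have hdom : (V t g).1.1 ∈ A.domain := LinearPMap.mem_domain_of_mem_graph (V t g).2
    have h := hBnd ⟨_, hdom⟩
    have hN2 : A ⟨J (V t g).1.1, hJdom _ hdom⟩ = (N (V t g)).1.2 :=
      A.mem_graph_snd_inj (A.mem_graph ⟨J (V t g).1.1, hJdom _ hdom⟩) (N (V t g)).2 (hNJ _).symm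
    rw [hN2, A.mem_graph_snd_inj (A.mem_graph ⟨_, hdom⟩) (V t g).2 rfl] at h
    have h1 : ‖(V t g).1.1‖₊ = ‖g.1.1‖₊ := NNReal.eq (hiso t _)
    rw [h1, show ‖(V t g).1.2‖ = ‖g.1.2‖ from hiso t _] at h
    exact (hiso (-t) _).trans_le h
  suffices hbdd : ∀ T > (0 : ℝ), ∀ ψ : ℝ → A.graph,
      ψ 0 = ⟨(φ₀, A ⟨φ₀, hφ₀⟩), A.mem_graph ⟨φ₀, hφ₀⟩⟩ →
      IsIntegralCurveOn ψ F (Ico 0 T) → ∃ M : ℝ, ∀ t ∈ Ico (0 : ℝ) T, ‖ψ t‖ ≤ M by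
    obtain ⟨ψ, hψ0, hψ⟩ := exists_isIntegralCurveOn_Ici (v := F)
      (fun x => hF.comp (continuous_id.prodMk continuous_const))
      (fun t => by simp only [F, hV0, hN0]) hFlip _ hbdd
    have h := isSolOn_of_isIntegralCurveOn hiso hzero hcont hU hF hFJ hψ
    rw [hψ0] at h
    exact ⟨_, h⟩
  intro T hT ψ hψ0 hψ
  have h := isSolOn_of_isIntegralCurveOn hiso hzero hcont hU hF hFJ hψ
  rw [hψ0] at h
  obtain ⟨M, hM⟩ := hapriori T hT _ h
  have hM' : ∀ t ∈ Ico 0 T, ‖(ψ t).1.1‖ ≤ M := fun t ht => (hiso t _).symm.trans_le (hM t ht)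
  let S : A.graph →L[ℝ] H :=
    ((ContinuousLinearMap.snd ℂ H H).comp A.graph.subtypeL).restrictScalars ℝ
  have hψ2 : ∀ t ∈ Ico 0 T, HasDerivWithinAt (fun t => (ψ t).1.2) (F t (ψ t)).1.2 (Ico 0 T) t :=
    fun t ht => S.hasFDerivAt.comp_hasDerivWithinAt t (hψ t ht)
  let K : ℝ := C₂ M.toNNReal
  refine ⟨max M (‖A ⟨φ₀, hφ₀⟩‖ * Real.exp (K * T)), fun t ht => max_le_max (hM' t ht) ?_⟩
  have hsub : Icc 0 t ⊆ Ico 0 T := fun s hs => ⟨hs.1, hs.2.trans_lt ht.2⟩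
  have hgr := norm_le_gronwallBound_of_norm_deriv_right_le (f := fun t => (ψ t).1.2)
    (f' := fun t => (F t (ψ t)).1.2) (a := 0) (b := t) (δ := ‖A ⟨φ₀, hφ₀⟩‖) (K := K) (ε := 0)
    (fun s hs => (hψ2 s (hsub hs)).continuousWithinAt.mono hsub)
    (fun s hs => by
      have hs' := hsub (Ico_subset_Icc_self hs)
      exact (hψ2 s hs').mono_of_mem_nhdsWithin
        (Filter.mem_of_superset (Ico_mem_nhdsGE hs'.2) (Ico_subset_Ico_left hs'.1)))
    (by rw [hψ0])
    (fun s hs => by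
      rw [add_zero]
      refine (hFbnd s _).trans (mul_le_mul_of_nonneg_right (NNReal.coe_le_coe.2 (hC₂mono ?_))
        (norm_nonneg _))
      exact NNReal.coe_le_coe.1 ((hM' s (hsub (Ico_subset_Icc_self hs))).trans
        (Real.le_coe_toNNReal M))) t ⟨ht.1, le_rfl⟩
  rw [gronwallBound_ε0, sub_zero] at hgr
  refine hgr.trans ?_
  have := ht.2.le
  gcongr
end

section
/- Let A > 0, C > 0 and k > 0, let γ(±k) = {±k − i·y : y ≥ 0}, and let g : ℂ → ℂ be holomorphic on ℂ \ (γ(k) ∪ γ(−k)) with |g(z)| ≤ C·e^{A|z|} for every z with Im z ≥ 0, z ∉ {k, −k}. Let w ∈ ℂ with Re w > A. For 0 < η < k define Φ₀^η(w) = ∫₀^{k−η} g(s)e^{−ws} ds + ∫_{γ_η(k)} g(z)e^{−wz} dz + ∫_{k+η}^{∞} g(s)e^{−ws} ds, where γ_η(k) is the upper half-circle path θ ↦ k + η·e^{iθ} traversed from θ = π to θ = 0. Then the improper integral ∫₀^{∞} g(s)e^{−ws} ds converges and lim_{η → 0⁺} Φ₀^η(w) = ∫₀^{∞} g(s)e^{−ws}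 ds. -/
open MeasureTheory Filter Set Complex

/-- The vertical branch cut hanging downwards from the real point `a` :
`γ(a) = {a − i·y : y ≥ 0}`. -/
def branchCut (a : ℝ) : Set ℂ := {z : ℂ | z.re = a ∧ z.im ≤ 0}

/-- The deformed contour integral `Φ₀^η(w)` : the integral of `g(z)·e^{−wz}`
along the positive real axis with the branch point `k` bypassed by the upper
half-circle `γ_η(k) : θ ↦ k + η·e^{iθ}` traversed from `θ = π` to `θ = 0`. -/
noncomputable def PhiEta (g : ℂ → ℂ) (k : ℝ) (w : ℂ) (η : ℝ) : ℂ :=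
  (∫ s in (0:ℝ)..(k - η), g s * Complex.exp (-w * s)) +
  (∫ θ in Real.pi..(0:ℝ),
      g (k + η * Complex.exp (θ * Complex.I)) *
        Complex.exp (-w * (k + η * Complex.exp (θ * Complex.I))) *
        (η * Complex.I * Complex.exp (θ * Complex.I))) +
  ∫ s in Set.Ioi (k + η), g s * Complex.exp (-w * s)

/-- The Laplace integrand `g(s)·e^{−ws}` is absolutely integrable on the positive real axis. -/
theorem integrableOn_laplace_integrand {A C k : ℝ} (hk : 0 < k) {g : ℂ → ℂ}
    (hol : DifferentiableOn ℂ g (branchCut k ∪ branchCut (-k))ᶜ)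
    (hgrow : ∀ z : ℂ, 0 ≤ z.im → z ≠ (k : ℂ) → z ≠ (-k : ℂ) →
      ‖g z‖ ≤ C * Real.exp (A * ‖z‖))
    {w : ℂ} (hw : A < w.re) :
    IntegrableOn (fun s : ℝ => g s * Complex.exp (-w * s)) (Ioi 0) := by
  have hcont : ContinuousOn (fun s : ℝ => g s * Complex.exp (-w * s)) (Ioi 0 \ {k}) := by
    refine ContinuousOn.mul (hol.continuousOn.comp continuous_ofReal.continuousOn ?_)
      (by fun_prop)
    rintro s ⟨hs, hsk⟩
    simp only [mem_Ioi, mem_singleton_iff] at hs hsk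
    simp only [branchCut, mem_compl_iff, mem_union, mem_ofPred_eq, ofReal_re, ofReal_im, le_refl,
      and_true, not_or]
    exact ⟨hsk, by linarith⟩
  have hset : (Ioi 0 \ {k} : Set ℝ) =ᵐ[volume] Ioi 0 :=
    sdiff_null_ae_eq_self (measure_singleton k)
  rw [← integrableOn_congr_set_ae hset]
  have hmeas : MeasurableSet (Ioi 0 \ {k} : Set ℝ) := by measurability
  have hexp : IntegrableOn (fun s : ℝ => C * Real.exp (-(w.re - A) * s)) (Ioi 0 \ {k}) :=
    ((exp_neg_integrableOn_Ioi 0 (sub_pos.2 hw)).mono_set sdiff_subset).const_mul C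
  refine Integrable.mono' hexp (hcont.aestronglyMeasurable hmeas) ?_
  filter_upwards [ae_restrict_mem hmeas] with s hs
  obtain ⟨hs, hsk⟩ := hs
  simp only [mem_Ioi, mem_singleton_iff] at hs hsk
  have hg := hgrow s (by simp) (by exact_mod_cast hsk)
    (by intro h; have h' : s = -k := by exact_mod_cast h
        linarith)
  rw [norm_mul, Complex.norm_exp]
  rw [Complex.norm_real, Real.norm_of_nonneg hs.le] at hg
  calc ‖g s‖ * Real.exp (-w * s).re
      ≤ C * Real.exp (A * s) * Real.exp (-w * s).re := by gcongr
    _ = C * Real.exp (-(w.re - A) * s) := by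
        rw [mul_assoc, ← Real.exp_add]
        congr 2
        simp
        ring

/-- The contribution of the shrinking upper half-circle around the branch point vanishes. -/
theorem tendsto_upper_arc_integral {A C k : ℝ} (hA : 0 < A) (hC : 0 < C) {g : ℂ → ℂ}
    (hgrow : ∀ z : ℂ, 0 ≤ z.im → z ≠ (k : ℂ) → z ≠ (-k : ℂ) →
      ‖g z‖ ≤ C * Real.exp (A * ‖z‖)) (w : ℂ) :
    Tendsto (fun η : ℝ => ∫ θ in Real.pi..(0:ℝ),
      g (k + η * Complex.exp (θ * Complex.I)) *
        Complex.exp (-w * (k + η * Complex.exp (θ * Complex.I))) *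
        (η * Complex.I * Complex.exp (θ * Complex.I)))
      (nhdsWithin 0 (Ioo 0 k)) (nhds 0) := by
  set M : ℝ := C * Real.exp (A * (2 * k)) * Real.exp (‖w‖ * (2 * k)) with hM
  have hlim : Tendsto (fun η : ℝ => M * η * |0 - Real.pi|) (nhdsWithin 0 (Ioo 0 k)) (nhds 0) := by
    have : Continuous fun η : ℝ => M * η * |0 - Real.pi| := by fun_prop
    simpa using (this.tendsto 0).mono_left nhdsWithin_le_nhds
  refine squeeze_zero_norm' ?_ hlim
  filter_upwards [self_mem_nhdsWithin] with η ⟨hη, hηk⟩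
  refine intervalIntegral.norm_integral_le_of_norm_le_const fun θ hθ => ?_
  rw [uIoc_of_ge Real.pi_pos.le] at hθ
  set z : ℂ := k + η * Complex.exp (θ * Complex.I) with hz
  have hre : z.re = k + η * Real.cos θ := by simp [hz, Complex.exp_ofReal_mul_I_re]
  have him : z.im = η * Real.sin θ := by simp [hz, Complex.exp_ofReal_mul_I_im]
  have hzk : z ≠ k := by simp [hz, hη.ne']
  have hzk' : z ≠ -k := by
    intro h
    have h' : z.re = -k := by simp [h]
    nlinarith [Real.neg_one_le_cos θ]
  have hnorm : ‖z‖ ≤ 2 * k := by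
    calc ‖z‖ ≤ ‖(k : ℂ)‖ + ‖(η : ℂ) * Complex.exp (θ * Complex.I)‖ := norm_add_le _ _
      _ = k + η := by
        rw [norm_mul, Complex.norm_exp_ofReal_mul_I, Complex.norm_real, Complex.norm_real,
          Real.norm_of_nonneg hη.le, Real.norm_of_nonneg (hη.trans hηk).le, mul_one]
      _ ≤ 2 * k := by linarith
  have hg : ‖g z‖ ≤ C * Real.exp (A * (2 * k)) := by
    refine (hgrow z ?_ hzk hzk').trans (by gcongr)
    rw [him]
    exact mul_nonneg hη.le (Real.sin_nonneg_of_nonneg_of_le_pi hθ.1.le hθ.2)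
  have he : ‖Complex.exp (-w * z)‖ ≤ Real.exp (‖w‖ * (2 * k)) := by
    refine (Complex.norm_exp_le_exp_norm _).trans ?_
    rw [norm_mul, norm_neg]
    gcongr
  have hd : ‖(η : ℂ) * Complex.I * Complex.exp (θ * Complex.I)‖ = η := by
    rw [norm_mul, norm_mul, Complex.norm_exp_ofReal_mul_I, Complex.norm_real, Complex.norm_I,
      Real.norm_of_nonneg hη.le, mul_one, mul_one]
  rw [norm_mul, norm_mul, hd, hM]
  gcongr

/-- Contour-deformation lemma : for `g` holomorphic off the two branch cuts
`γ(±k)` with `|g(z)| ≤ C·e^{A|z|}` in the closed upper half-plane, and `w` with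
`Re w > A`, the improper integral `∫₀^∞ g(s)e^{−ws} ds` converges and the
deformed contour integrals `Φ₀^η(w)` converge to it as `η → 0⁺`. -/
theorem contour_deformation_limit
    (A C k : ℝ) (hA : 0 < A) (hC : 0 < C) (hk : 0 < k)
    (g : ℂ → ℂ)
    (hol : DifferentiableOn ℂ g (branchCut k ∪ branchCut (-k))ᶜ)
    (hgrow : ∀ z : ℂ, 0 ≤ z.im → z ≠ (k : ℂ) → z ≠ (-k : ℂ) →
      ‖g z‖ ≤ C * Real.exp (A * ‖z‖))
    (w : ℂ) (hw : A < w.re) :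
    ∃ L : ℂ,
      Tendsto (fun R : ℝ => ∫ s in (0:ℝ)..R, g s * Complex.exp (-w * s))
        atTop (nhds L) ∧
      Tendsto (fun η : ℝ => PhiEta g k w η) (nhdsWithin 0 (Set.Ioo 0 k))
        (nhds L) := by
  set f : ℝ → ℂ := fun s => g s * Complex.exp (-w * s) with hf
  have hint : IntegrableOn f (Ioi 0) := integrableOn_laplace_integrand hk hol hgrow hw
  have hii : ∀ x : ℝ, 0 ≤ x → IntervalIntegrable f volume 0 x := fun x hx =>
    (intervalIntegrable_iff_integrableOn_Ioc_of_le hx).2 (hint.mono_set Ioc_subset_Ioi_self)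
  refine ⟨∫ s in Ioi 0, f s, intervalIntegral_tendsto_integral_Ioi 0 hint tendsto_id, ?_⟩
  have hprim : ContinuousAt (fun x : ℝ => ∫ s in (0:ℝ)..x, f s) k := by
    refine (intervalIntegral.continuousOn_primitive_interval' (b₁ := 0) (b₂ := 2 * k)
      (hii _ (by linarith)) left_mem_uIcc).continuousAt ?_
    rw [uIcc_of_le (by linarith)]
    exact Icc_mem_nhds hk (by linarith)
  have hleft : Tendsto (fun η : ℝ => ∫ s in (0:ℝ)..(k - η), f s) (nhdsWithin 0 (Ioo 0 k))
      (nhds (∫ s in (0:ℝ)..k, f s)) := by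
    refine hprim.tendsto.comp (tendsto_nhdsWithin_of_tendsto_nhds ?_)
    exact Continuous.tendsto' (by fun_prop) _ _ (by simp)
  have hright : Tendsto (fun η : ℝ => ∫ s in (0:ℝ)..(k + η), f s) (nhdsWithin 0 (Ioo 0 k))
      (nhds (∫ s in (0:ℝ)..k, f s)) := by
    refine hprim.tendsto.comp (tendsto_nhdsWithin_of_tendsto_nhds ?_)
    exact Continuous.tendsto' (by fun_prop) _ _ (by simp)
  have htail : Tendsto (fun η : ℝ => ∫ s in Ioi (k + η), f s) (nhdsWithin 0 (Ioo 0 k))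
      (nhds ((∫ s in Ioi 0, f s) - ∫ s in (0:ℝ)..k, f s)) := by
    refine (hright.const_sub (∫ s in Ioi 0, f s)).congr' ?_
    filter_upwards [self_mem_nhdsWithin] with η ⟨hη, _⟩
    have hpos : 0 ≤ k + η := by linarith
    rw [← intervalIntegral.integral_interval_add_Ioi hint
      (hint.mono_set (Ioi_subset_Ioi hpos)), add_sub_cancel_left]
  have hsum := (hleft.add (tendsto_upper_arc_integral hA hC hgrow w)).add htail
  rw [add_zero, add_sub_cancel] at hsum
  exact hsum
end
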